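/- arXiv:math/0609463 — 3 statements merged into one kernel-verified Lean document; each statement's English description precedes it below -/
import Mathlib

section
/- Let Z₁, Z₂ be bounded metric spaces of positive diameter such that the spaces of the family {a·Z₁ × b·Z₂ : a ≥ 1, b ≥ 1} (products with the l∞ metric) have ℓ-dim ≤ k uniformly. Then asdim(Co(Z₁) × Co(Z₂)) ≤ k + 2, where Co denotes the hyperbolic cone and the product carries the l∞ metric. -/
open Metric Set Filter ENNReal NNReal

noncomputable section

namespace PaperDefs

/-! ### Coverings: mesh, Lebesgue number, colorings, multiplicity -/

/-- The mesh of a family of subsets of a metric space. -/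
def meshF {Z : Type*} [PseudoMetricSpace Z] (U : Set (Set Z)) : ℝ≥0∞ :=
  ⨆ V ∈ U, EMetric.diam V

/-- The Lebesgue number of a family `U` as a covering of `A`:
`inf_{z ∈ A} sup_{V ∈ U} dist (z, Z \ V)`. -/
def lebesgueF {Z : Type*} [PseudoMetricSpace Z] (U : Set (Set Z)) (A : Set Z) : ℝ≥0∞ :=
  ⨅ z ∈ A, ⨆ V ∈ U, EMetric.infEdist z Vᶜ

def IsOpenFamily {Z : Type*} [TopologicalSpace Z] (U : Set (Set Z)) : Prop :=
  ∀ V ∈ U, IsOpen V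

def IsCoveringOf {Z : Type*} (U : Set (Set Z)) (A : Set Z) : Prop :=
  A ⊆ ⋃₀ U

/-- A family is `m`-colored if it is a union of `m` families, each consisting of
pairwise disjoint sets. -/
def IsColored {Z : Type*} (U : Set (Set Z)) (m : ℕ) : Prop :=
  ∃ F : Fin m → Set (Set Z), U = ⋃ i, F i ∧ ∀ i, (F i).Pairwise Disjoint

/-- The multiplicity of a family is at most `m`: any collection of its members with a
common point has cardinality at most `m`. -/
def MultiplicityLE {Z : Type*} (U : Set (Set Z)) (m : ℕ) : Prop :=
  ∀ s : Finset (Set Z), ↑s ⊆ U → (⋂₀ (s : Set (Set Z))).Nonempty → s.card ≤ m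

/-- An `(L, M, n)`-covering of `A`: an open `n`-colored covering with mesh at most `M`
and Lebesgue number at least `L`. -/
def IsLMNCover {Z : Type*} [PseudoMetricSpace Z] (U : Set (Set Z)) (A : Set Z)
    (L M : ℝ) (n : ℕ) : Prop :=
  IsOpenFamily U ∧ IsCoveringOf U A ∧ IsColored U n ∧
    meshF U ≤ ENNReal.ofReal M ∧ ENNReal.ofReal L ≤ lebesgueF U A

/-! ### Dimensions -/

/-- `ℓ-dim Z ≤ k`. -/
def ElldimLE (Z : Type*) [PseudoMetricSpace Z] (k : ℕ) : Prop :=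
  ∃ δ : ℝ, δ ∈ Set.Ioo (0:ℝ) 1 ∧ ∃ τ₀ : ℝ, 0 < τ₀ ∧ ∀ τ : ℝ, 0 < τ → τ < τ₀ →
    ∃ U : Set (Set Z), IsLMNCover U Set.univ (δ * τ) τ (k + 1)

/-- The linearly controlled dimension of a metric space. -/
def elldim (Z : Type*) [PseudoMetricSpace Z] : ℕ∞ :=
  sInf {n : ℕ∞ | ∃ k : ℕ, n = k ∧ ElldimLE Z k}

/-- `asdim X ≤ m`. -/
def AsdimLE (X : Type*) [PseudoMetricSpace X] (m : ℕ) : Prop :=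
  ∀ d : ℝ, 0 < d → ∃ U : Set (Set X), IsOpenFamily U ∧ IsCoveringOf U Set.univ ∧
    MultiplicityLE U (m + 1) ∧ meshF U < ⊤ ∧ ENNReal.ofReal d ≤ lebesgueF U Set.univ

/-- The asymptotic dimension of a metric space. -/
def asdim (X : Type*) [PseudoMetricSpace X] : ℕ∞ :=
  sInf {n : ℕ∞ | ∃ m : ℕ, n = m ∧ AsdimLE X m}

/-- `ℓ-asdim X ≤ n`. -/
def LasdimLE (X : Type*) [PseudoMetricSpace X] (n : ℕ) : Prop :=
  ∃ C : ℝ, 1 < C ∧ ∃ d₀ : ℝ, ∀ d : ℝ, d₀ ≤ d →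
    ∃ U : Set (Set X), IsLMNCover U Set.univ d (C * d) (n + 1)

/-- The linearly controlled asymptotic dimension of a metric space. -/
def lasdim (X : Type*) [PseudoMetricSpace X] : ℕ∞ :=
  sInf {n : ℕ∞ | ∃ m : ℕ, n = m ∧ LasdimLE X m}

/-- Topological covering dimension `≤ m`: every open covering admits an open refinement of
multiplicity at most `m + 1`. -/
def CovDimLE (Z : Type*) [TopologicalSpace Z] (m : ℕ) : Prop :=
  ∀ U : Set (Set Z), IsOpenFamily U → IsCoveringOf U Set.univ →
    ∃ V : Set (Set Z), IsOpenFamily V ∧ IsCoveringOf V Set.univ ∧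
      (∀ W ∈ V, ∃ W' ∈ U, W ⊆ W') ∧ MultiplicityLE V (m + 1)

/-- Topological covering dimension. -/
def covDim (Z : Type*) [TopologicalSpace Z] : ℕ∞ :=
  sInf {n : ℕ∞ | ∃ m : ℕ, n = m ∧ CovDimLE Z m}

/-! ### Scaled metric spaces and uniform `ℓ-dim` for families -/

/-- `Scaled a X` is the metric space obtained from `X` by multiplying all distances by `a`. -/
def Scaled (a : ℝ≥0) (X : Type*) : Type _ := X

def Scaled.unmk {a : ℝ≥0} {X : Type*} (x : Scaled a X) : X := x

def Scaled.dist' (a : ℝ≥0) {X : Type*} [PseudoMetricSpace X] (x y : Scaled a X) : ℝ :=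
  a * dist x.unmk y.unmk

noncomputable instance Scaled.pseudoMetricSpace (a : ℝ≥0) (X : Type*) [PseudoMetricSpace X] :
    PseudoMetricSpace (Scaled a X) where
  dist := Scaled.dist' a
  dist_self x := by simp [Scaled.dist']
  dist_comm x y := by simp [Scaled.dist', dist_comm]
  dist_triangle x y z := by
    have h := dist_triangle x.unmk y.unmk z.unmk
    have h2 := mul_le_mul_of_nonneg_left h a.coe_nonneg
    simp only [Scaled.dist']
    calc (a : ℝ) * dist x.unmk z.unmk ≤ a * (dist x.unmk y.unmk + dist y.unmk z.unmk) := h2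
      _ = a * dist x.unmk y.unmk + a * dist y.unmk z.unmk := by ring

/-- A family of metric spaces has `ℓ-dim ≤ k` uniformly. -/
def UnifElldimLE {ι : Type*} (Z : ι → Type*) [∀ i, PseudoMetricSpace (Z i)] (k : ℕ) : Prop :=
  ∃ δ : ℝ, δ ∈ Set.Ioo (0:ℝ) 1 ∧ ∃ τ₀ : ℝ, 0 < τ₀ ∧ ∀ τ : ℝ, 0 < τ → τ < τ₀ → ∀ i : ι,
    ∃ U : Set (Set (Z i)), IsLMNCover U Set.univ (δ * τ) τ (k + 1)

/-! ### `mesh^×` and `L^×` for products -/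

/-- `mesh^× U ≤ (p, q)`. -/
def MeshProdLE {X Y : Type*} [PseudoMetricSpace X] [PseudoMetricSpace Y]
    (U : Set (Set (X × Y))) (p q : ℝ) : Prop :=
  ∀ V ∈ U, ∃ x : X, ∃ y : Y, V ⊆ closedBall x p ×ˢ closedBall y q

/-- `L^× U ≥ (p, q)`. -/
def LProdGE {X Y : Type*} [PseudoMetricSpace X] [PseudoMetricSpace Y]
    (U : Set (Set (X × Y))) (p q : ℝ) : Prop :=
  ∀ z : X × Y, ∃ V ∈ U, closedBall z.1 p ×ˢ closedBall z.2 q ⊆ V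

/-- pointed `mesh^× (U, z) ≤ (p, q)`. -/
def MeshProdAtLE {X Y : Type*} [PseudoMetricSpace X] [PseudoMetricSpace Y]
    (U : Set (Set (X × Y))) (z : X × Y) (p q : ℝ) : Prop :=
  ∀ V ∈ U, z ∈ V → ∃ x : X, ∃ y : Y, V ⊆ closedBall x p ×ˢ closedBall y q

/-- pointed `L^× (U, z) ≥ (p, q)`. -/
def LProdAtGE {X Y : Type*} [PseudoMetricSpace X] [PseudoMetricSpace Y]
    (U : Set (Set (X × Y))) (z : X × Y) (p q : ℝ) : Prop :=
  ∃ V ∈ U, closedBall z.1 p ×ˢ closedBall z.2 q ⊆ V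

/-! ### Hyperbolic spaces and their boundaries -/

/-- The Gromov product `(x|y)_o`. -/
def gromov {Z : Type*} [PseudoMetricSpace Z] (o x y : Z) : ℝ :=
  (dist x o + dist y o - dist x y) / 2

/-- `X` is `δ`-hyperbolic. -/
def IsDeltaHyperbolic (X : Type*) [PseudoMetricSpace X] (δ : ℝ) : Prop :=
  0 ≤ δ ∧ ∀ o x y z : X, min (gromov o x z) (gromov o z y) - δ ≤ gromov o x y

/-- `X` is Gromov hyperbolic. -/
def GromovHyperbolic (X : Type*) [PseudoMetricSpace X] : Prop :=
  ∃ δ : ℝ, IsDeltaHyperbolic X δ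

/-- A sequence converges at infinity if `liminf_{i,j → ∞} (x_i | x_j)_o = ∞`. -/
def ConvAtInf {X : Type*} [PseudoMetricSpace X] (o : X) (x : ℕ → X) : Prop :=
  Tendsto (fun p : ℕ × ℕ => gromov o (x p.1) (x p.2)) (atTop ×ˢ atTop) atTop

/-- Sequences converging at infinity. -/
def BdrySeq (X : Type*) [PseudoMetricSpace X] (o : X) := {x : ℕ → X // ConvAtInf o x}

/-- Equivalence of sequences converging at infinity. -/
def bdryRel (X : Type*) [PseudoMetricSpace X] (o : X) (x y : BdrySeq X o) : Prop :=
  Tendsto (fun p : ℕ × ℕ => gromov o (x.1 p.1) (y.1 p.2)) (atTop ×ˢ atTop) atTop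

/-- The boundary at infinity of `X` (with respect to the base point `o`). -/
def Boundary (X : Type*) [PseudoMetricSpace X] (o : X) := Quot (bdryRel X o)

/-- The Gromov product of two boundary points. -/
def bGromov {X : Type*} [PseudoMetricSpace X] (o : X) (ξ η : Boundary X o) : ℝ :=
  sInf {t : ℝ | ∃ x y : BdrySeq X o, Quot.mk (bdryRel X o) x = ξ ∧ Quot.mk (bdryRel X o) y = η ∧
    t = liminf (fun p : ℕ × ℕ => gromov o (x.1 p.1) (y.1 p.2)) (atTop ×ˢ atTop)}

/-- The Gromov product of a point of the space and a boundary point. -/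
def mGromov {X : Type*} [PseudoMetricSpace X] (o : X) (x : X) (ξ : Boundary X o) : ℝ :=
  sInf {t : ℝ | ∃ y : BdrySeq X o, Quot.mk (bdryRel X o) y = ξ ∧
    t = liminf (fun j : ℕ => gromov o x (y.1 j)) atTop}

/-- A hyperbolic space is visual. -/
def IsVisualSpace (X : Type*) [PseudoMetricSpace X] : Prop :=
  ∃ x₀ : X, ∃ D : ℝ, 0 < D ∧ ∀ x : X, ∃ ξ : Boundary X x₀,
    dist x x₀ ≤ mGromov x₀ x ξ + D

/-- `B` is a copy of the boundary at infinity of `X` (realized by the bijection `φ`)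
equipped with a visual metric. -/
def IsVisualBoundary (X : Type*) [PseudoMetricSpace X] (o : X)
    (B : Type*) [PseudoMetricSpace B] (φ : B ≃ Boundary X o) : Prop :=
  ∃ a : ℝ, 1 < a ∧ ∃ c₁ c₂ : ℝ, 0 < c₁ ∧ 0 < c₂ ∧ ∀ ξ ξ' : B,
    c₁ * a ^ (-(bGromov o (φ ξ) (φ ξ'))) ≤ dist ξ ξ' ∧
    dist ξ ξ' ≤ c₂ * a ^ (-(bGromov o (φ ξ) (φ ξ')))

/-- A geodesic from `x` to `y`: an isometric parametrization of `[0, dist x y]`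
sending `0` to `x` and `dist x y` to `y`. -/
def IsGeodesicFrom {Z : Type*} [PseudoMetricSpace Z] (f : ℝ → Z) (x y : Z) : Prop :=
  f 0 = x ∧ f (dist x y) = y ∧ ∀ s ∈ Set.Icc (0:ℝ) (dist x y), ∀ t ∈ Set.Icc (0:ℝ) (dist x y),
    dist (f s) (f t) = |s - t|

/-- A geodesic metric space. -/
def IsGeodesicSpace (X : Type*) [PseudoMetricSpace X] : Prop :=
  ∀ x y : X, ∃ f : ℝ → X, IsGeodesicFrom f x y

/-! ### Word metrics and hyperbolic groups -/

/-- The word length of `g` with respect to the (symmetrized) generating set `S`. -/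
def wordLength {G : Type*} [Group G] (S : Set G) (g : G) : ℕ :=
  sInf {n : ℕ | ∃ w : List G, w.length = n ∧ (∀ s ∈ w, s ∈ S ∨ s⁻¹ ∈ S) ∧ w.prod = g}

/-- The metric on `G` is the word metric of the finite generating set `S`. -/
def IsWordMetric {G : Type*} [Group G] [PseudoMetricSpace G] (S : Set G) : Prop :=
  S.Finite ∧ Subgroup.closure S = ⊤ ∧ ∀ g h : G, dist g h = wordLength S (g⁻¹ * h)

/-! ### Hyperbolic cones -/

/-- The inverse hyperbolic cosine. -/
def arcosh (x : ℝ) : ℝ := Real.log (x + Real.sqrt (x ^ 2 - 1))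

/-- The hyperbolic cone distance between points of `Z × [0, ∞)`, where `Z` is a bounded
metric space of positive diameter:
`cosh d = cosh t · cosh t' − sinh t · sinh t' · cos (μ |z z'|)` with `μ = π / diam Z`. -/
def coneDist {Z : Type*} [PseudoMetricSpace Z] (p q : Z × ℝ≥0) : ℝ :=
  arcosh (Real.cosh p.2 * Real.cosh q.2 -
    Real.sinh p.2 * Real.sinh q.2 *
      Real.cos (Real.pi / Metric.diam (Set.univ : Set Z) * dist p.1 q.1))

/-- `C` is (a realization of) the hyperbolic cone over `Z`: `h` is the canonical projection
of `Z × [0, ∞)` onto `C = Z × [0,∞) / Z × {0}`, and the metric of `C` is the hyperbolic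
cone metric. -/
def IsHypCone (Z : Type*) [PseudoMetricSpace Z] (C : Type*) [PseudoMetricSpace C]
    (h : Z × ℝ≥0 → C) : Prop :=
  Function.Surjective h ∧ ∀ p q : Z × ℝ≥0, dist (h p) (h q) = coneDist p q

/-- A metric space is locally self-similar. -/
def LocallySelfSimilar (Z : Type*) [PseudoMetricSpace Z] : Prop :=
  ∃ lam : ℝ, 1 ≤ lam ∧ ∃ R₀ : ℝ, 1 < R₀ ∧ ∀ R : ℝ, R₀ ≤ R → ∀ A : Set Z,
    Metric.diam A ≤ 1 / R → ∃ f : A → Z, ∀ x y : A,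
      R * dist (x : Z) (y : Z) / lam ≤ dist (f x) (f y) ∧
      dist (f x) (f y) ≤ lam * R * dist (x : Z) (y : Z)

end PaperDefs

open PaperDefs

/-! ### Covers of subsets at a given scale -/

/-- `A` has an `N`-colored family of sets of diameter at most `D` whose Lebesgue number
on `A` is at least `r`. -/
def HasColoredCover {X : Type*} [PseudoMetricSpace X] (A : Set X) (r D : ℝ) (N : ℕ) : Prop :=
  ∃ F : Fin N → Set (Set X),
    (∀ c, ∀ U ∈ F c, ∀ V ∈ F c, ∀ x, x ∈ U → x ∈ V → U = V) ∧
    (∀ c, ∀ U ∈ F c, ∀ x ∈ U, ∀ y ∈ U, dist x y ≤ D) ∧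
    ∀ x ∈ A, ∃ c, ∃ U ∈ F c, ∀ y ∈ A, dist x y ≤ r → y ∈ U

/-- `A` has a family of sets of diameter at most `D` and multiplicity at most `N` whose Lebesgue
number on `A` is at least `r`. -/
def HasMultCover {X : Type*} [PseudoMetricSpace X] (A : Set X) (r D : ℝ) (N : ℕ) : Prop :=
  ∃ F : Set (Set X),
    (∀ x, {U ∈ F | x ∈ U}.Finite ∧ {U ∈ F | x ∈ U}.ncard ≤ N) ∧
    (∀ U ∈ F, ∀ x ∈ U, ∀ y ∈ U, dist x y ≤ D) ∧
    ∀ x ∈ A, ∃ U ∈ F, ∀ y ∈ A, dist x y ≤ r → y ∈ U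

lemma finite_and_ncard_le_of_rel {α : Type*} {S : Set α} {N : ℕ} (R : α → Fin N → Prop)
    (h₁ : ∀ a ∈ S, ∃ i, R a i) (h₂ : ∀ a b i, R a i → R b i → a = b) :
    S.Finite ∧ S.ncard ≤ N := by
  choose g hg using fun a : S => h₁ a a.2
  have hinj : Function.Injective g := fun a b hab =>
    Subtype.ext (h₂ _ _ (g a) (hg a) (hab ▸ hg b))
  refine ⟨Set.finite_coe_iff.mp (Finite.of_injective _ hinj), ?_⟩
  have := Nat.card_le_card_of_injective _ hinj
  simpa [Nat.card_coe_set_eq] using this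

/-- A cover of multiplicity `N` yields an `N`-colored cover with a smaller Lebesgue number. -/
lemma HasMultCover.hasColoredCover {X : Type*} [PseudoMetricSpace X] {A : Set X} {r D : ℝ}
    {N : ℕ} (hr : 0 ≤ r) (h : HasMultCover A r D N) :
    HasColoredCover A (r / (2 * N + 1)) D N := by
  obtain ⟨F, hmult, hmesh, hleb⟩ := h
  set ρ : ℝ := r / (2 * N + 1) with hρ
  have hρ0 : 0 ≤ ρ := by positivity
  have hρr : 2 * N * ρ ≤ r := by
    have : (2 * N + 1) * ρ = r := by rw [hρ]; field_simp
    linarith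
  -- the members of `F` that contain the ball of radius `j * ρ` about `y`
  let S : ℕ → X → Set (Set X) := fun j y => {U ∈ F | ∀ z ∈ A, dist y z ≤ j * ρ → z ∈ U}
  have hS0 : ∀ j, ∀ y ∈ A, S j y ⊆ {U ∈ F | y ∈ U} := fun j y hy U hU =>
    ⟨hU.1, hU.2 y hy (by rw [dist_self]; positivity)⟩
  have hSfin : ∀ j, ∀ y ∈ A, (S j y).Finite := fun j y hy => (hmult y).1.subset (hS0 j y hy)
  have hSanti : ∀ y, ∀ i j, i ≤ j → S j y ⊆ S i y := fun y i j hij U hU =>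
    ⟨hU.1, fun z hz hd => hU.2 z hz (hd.trans (by gcongr))⟩
  have hSmove : ∀ j x y, dist x y ≤ ρ → S (j + 1) x ⊆ S j y := fun j x y hxy U hU =>
    ⟨hU.1, fun z hz hd => hU.2 z hz (by
      push_cast; linarith [dist_triangle x y z])⟩
  let W : Set (Set X) → Set X := fun T => {y ∈ A | ∃ j, S j y = T}
  refine ⟨fun c => {V | ∃ T : Set (Set X), T.ncard = c + 1 ∧ V = W T}, ?_, ?_, ?_⟩
  · rintro c _ ⟨T, hT, rfl⟩ _ ⟨T', hT', rfl⟩ x ⟨hxA, j, hj⟩ ⟨-, j', hj'⟩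
    have : T = T' := by
      subst hj hj'
      rcases le_total j j' with hle | hle
      · exact (Set.eq_of_subset_of_ncard_le (hSanti x _ _ hle) (by omega) (hSfin _ _ hxA)).symm
      · exact Set.eq_of_subset_of_ncard_le (hSanti x _ _ hle) (by omega) (hSfin _ _ hxA)
    rw [this]
  · rintro c _ ⟨T, hT, rfl⟩ x ⟨hxA, j, hj⟩ y ⟨hyA, j', hj'⟩
    obtain ⟨U, hU⟩ : T.Nonempty := Set.nonempty_of_ncard_ne_zero (by omega)
    exact hmesh U (hS0 j x hxA (hj ▸ hU)).1 x (hS0 j x hxA (hj ▸ hU)).2 y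
      (hS0 j' y hyA (hj' ▸ hU)).2
  · intro x hx
    obtain ⟨U₀, hU₀, hU₀'⟩ := hleb x hx
    have hlast : U₀ ∈ S (2 * N) x := ⟨hU₀, fun z hz hd => hU₀' z hz (hd.trans (by
      push_cast; exact hρr))⟩
    obtain ⟨i, hi, hiS⟩ : ∃ i < N, S (2 * i) x = S (2 * i + 2) x := by
      by_contra! hne
      have key : ∀ i ≤ N, (S (2 * i) x).ncard + i ≤ N := by
        intro i
        induction i with
        | zero =>
          intro _
          exact (Set.ncard_le_ncard (hS0 _ x hx) (hmult x).1).trans (hmult x).2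
        | succ i ih =>
          intro hi
          have h1 := ih (by omega)
          have h2 : S (2 * i + 2) x ⊂ S (2 * i) x :=
            (hSanti x _ _ (by omega)).ssubset_of_ne (hne i (by omega)).symm
          have h3 := Set.ncard_lt_ncard h2 (hSfin _ x hx)
          have h4 : 2 * (i + 1) = 2 * i + 2 := by ring
          rw [h4]; omega
      have h0 : (S (2 * N) x).ncard = 0 := by have := key N le_rfl; omega
      rw [Set.ncard_eq_zero (hSfin _ x hx)] at h0
      rw [h0] at hlast
      exact hlast
    have hne : (S (2 * i) x).Nonempty := ⟨U₀, hSanti x _ _ (by omega) hlast⟩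
    have hpos : 0 < (S (2 * i) x).ncard := (Set.ncard_pos (hSfin _ x hx)).2 hne
    have hle : (S (2 * i) x).ncard ≤ N :=
      (Set.ncard_le_ncard (hS0 _ x hx) (hmult x).1).trans (hmult x).2
    refine ⟨⟨(S (2 * i) x).ncard - 1, by omega⟩, W (S (2 * i) x), ⟨_, ?_, rfl⟩, ?_⟩
    · simp only; omega
    · intro y hy hxy
      refine ⟨hy, 2 * i + 1, Set.Subset.antisymm (hSmove _ _ _ (by rwa [dist_comm])) ?_⟩
      rw [hiS]
      exact hSmove _ _ _ hxy

/-- Gluing of covers of strips of a `1`-Lipschitz function, at two different scales, at the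
expense of increasing the multiplicity by one. -/
lemma hasMultCover_of_strips_aux {X : Type*} [PseudoMetricSpace X] {A : Set X} {f : X → ℝ}
    (hf : ∀ x y, |f x - f y| ≤ dist x y) {N : ℕ} {r D D' P : ℝ} (hr : 0 < r)
    (hP : P = (6 * N + 10) * r)
    (hfine : ∀ t, HasColoredCover (A ∩ {x | |f x - t| ≤ P}) r D N)
    (hcoarse : ∀ t, HasColoredCover (A ∩ {x | |f x - t| ≤ P}) (max D r) D' N) :
    HasMultCover A r (max D D') (N + 1) := by
  choose F hFd hFm hFl using fun e : ℤ => hfine (P * e)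
  choose C hCd hCm hCl using fun e : ℤ => hcoarse (P * e)
  have hNr : 0 ≤ N * r := by positivity
  have hP0 : 0 < P := by rw [hP]; positivity
  have hcN : ∀ c : Fin N, ((c : ℕ) + 1 : ℝ) * r ≤ N * r := fun c => by
    have : ((c : ℕ) + 1 : ℝ) ≤ N := by exact_mod_cast c.2
    gcongr
  have hc0 : ∀ c : Fin N, r ≤ ((c : ℕ) + 1 : ℝ) * r := fun c => by
    have : (0 : ℝ) ≤ (c : ℕ) * r := by positivity
    linarith
  have hstep : ∀ m m' : ℤ, m + 1 ≤ m' → P * (m + 1) ≤ P * m' := fun m m' h => by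
    have : (m + 1 : ℝ) ≤ m' := by exact_mod_cast h
    gcongr
  set b : ℝ := (3 * N + 1) * r with hb
  have hbP : P = 2 * b + 8 * r := by rw [hP, hb]; ring
  have hb0 : r ≤ b := by rw [hb]; linarith
  have huniq : ∀ (x : X) (e e' : ℤ), |f x - P * e| ≤ b → |f x - P * e'| ≤ b → e = e' := by
    intro x e e' h h'
    rw [abs_le] at h h'
    rcases lt_trichotomy e e' with hlt | heq | hlt
    · linarith [hstep e e' hlt]
    · exact heq
    · linarith [hstep e' e hlt]
  have huniq' : ∀ (x : X) (m m' : ℤ), P * m < f x → f x < P * (m + 1) → P * m' < f x →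
      f x < P * (m' + 1) → m = m' := by
    intro x m m' h1 h2 h3 h4
    rcases lt_trichotomy m m' with hlt | heq | hlt
    · linarith [hstep m m' hlt]
    · exact heq
    · linarith [hstep m' m hlt]
  have hπ : ∀ (m e : ℤ) (U : Set X), ∃ V : Set X, (∃ c, U ∈ F e c) →
      (∃ x ∈ U, x ∈ A ∧ P * m ≤ f x ∧ f x ≤ P * (m + 1)) →
      (∃ c, V ∈ C m c) ∧ ∀ y ∈ U, y ∈ A → P * m ≤ f y → f y ≤ P * (m + 1) → y ∈ V := by
    intro m e U
    by_cases h : (∃ c, U ∈ F e c) ∧ ∃ x ∈ U, x ∈ A ∧ P * m ≤ f x ∧ f x ≤ P * (m + 1)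
    · obtain ⟨⟨c, hU⟩, x, hxU, hxA, hx1, hx2⟩ := h
      obtain ⟨c', V, hV, hVy⟩ := hCl m x ⟨hxA, by
        simp only [Set.mem_ofPred_eq, abs_le]; constructor <;> linarith⟩
      refine ⟨V, fun _ _ => ⟨⟨c', hV⟩, fun y hyU hyA hy1 hy2 => hVy y ⟨hyA, ?_⟩ ?_⟩⟩
      · simp only [Set.mem_ofPred_eq, abs_le]; constructor <;> linarith
      · exact (hFm e c U hU x hxU y hyU).trans (le_max_left _ _)
    · exact ⟨∅, fun h1 h2 => absurd ⟨h1, h2⟩ h⟩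
  choose π hπ using hπ
  let Wf : ℤ → Fin N → Set X → Set X := fun e c U =>
    {x | x ∈ A ∧ x ∈ U ∧ |f x - P * e| ≤ 3 * (((c : ℕ) + 1 : ℝ) * r) + r}
  let Wc : ℤ → Set X → Set X := fun m V =>
    {x | x ∈ A ∧ x ∈ V ∧ P * m < f x ∧ f x < P * (m + 1) ∧
      ((b < f x - P * m ∧ b < P * (m + 1) - f x) ∨
        ∃ e : ℤ, |f x - P * e| ≤ b ∧ ∃ c, ∃ U ∈ F e c, x ∈ U ∧
          3 * (((c : ℕ) + 1 : ℝ) * r) - r ≤ |f x - P * e| ∧ V = π m e U)}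
  refine ⟨{W | (∃ e c U, U ∈ F e c ∧ W = Wf e c U) ∨ ∃ m c V, V ∈ C m c ∧ W = Wc m V},
    ?_, ?_, ?_⟩
  · intro x
    by_cases hx : ∃ e : ℤ, |f x - P * e| ≤ b
    · obtain ⟨e, he⟩ := hx
      refine finite_and_ncard_le_of_rel (fun W i =>
        (∃ (c : Fin N) (U : Set X), U ∈ F e c ∧ x ∈ U ∧
          |f x - P * e| ≤ 3 * (((c : ℕ) + 1 : ℝ) * r) + r ∧ W = Wf e c U ∧ i = c.succ) ∨
        (∃ (m : ℤ) (c : Fin N) (U : Set X), U ∈ F e c ∧ x ∈ U ∧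
          3 * (((c : ℕ) + 1 : ℝ) * r) - r ≤ |f x - P * e| ∧ P * m < f x ∧ f x < P * (m + 1) ∧
          W = Wc m (π m e U) ∧ i = c.castSucc)) ?_ ?_
      · rintro W ⟨⟨e', c, U, hU, rfl⟩ | ⟨m, c, V, hV, rfl⟩, hxW⟩
        · obtain ⟨-, hxU, hxe⟩ := hxW
          obtain rfl : e' = e := huniq x _ _ (hxe.trans (by rw [hb]; linarith [hcN c])) he
          exact ⟨_, Or.inl ⟨c, U, hU, hxU, hxe, rfl, rfl⟩⟩
        · obtain ⟨-, hxV, hm1, hm2, ⟨hf1, hf2⟩ | ⟨e', he', c', U, hU, hxU, hge, rfl⟩⟩ := hxW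
          · exfalso
            rw [abs_le] at he
            rcases lt_or_ge m e with hlt | hge
            · linarith [hstep m e hlt]
            · have := hstep (e - 1) m (by omega)
              push_cast at this
              linarith
          · obtain rfl : e' = e := huniq x _ _ he' he
            exact ⟨_, Or.inr ⟨m, c', U, hU, hxU, hge, hm1, hm2, rfl, rfl⟩⟩
      · have hcol : ∀ c c' : Fin N, |f x - P * e| ≤ 3 * (((c : ℕ) + 1 : ℝ) * r) + r →
            3 * (((c' : ℕ) + 1 : ℝ) * r) - r ≤ |f x - P * e| → c.succ ≠ c'.castSucc := by
          intro c c' h1 h2 heq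
          have h3 : (c : ℕ) + 1 = c' := by simpa [Fin.ext_iff] using heq
          have h4 : ((c : ℕ) + 1 : ℝ) = (c' : ℕ) := by exact_mod_cast h3
          rw [h4] at h1
          linarith
        rintro W W' i (⟨c, U, hU, hxU, h1, rfl, rfl⟩ | ⟨m, c, U, hU, hxU, h1, h2, h3, rfl, rfl⟩)
          (⟨c', U', hU', hxU', h1', rfl, hi⟩ | ⟨m', c', U', hU', hxU', h1', h2', h3', rfl, hi⟩)
        · obtain rfl := Fin.succ_injective _ hi
          rw [hFd e c U hU U' hU' x hxU hxU']
        · exact absurd hi (hcol c c' h1 h1')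
        · exact absurd hi.symm (hcol c' c h1' h1)
        · obtain rfl := Fin.castSucc_injective _ hi
          obtain rfl := huniq' x m m' h2 h3 h2' h3'
          rw [hFd e c U hU U' hU' x hxU hxU']
    · refine finite_and_ncard_le_of_rel (fun W i =>
        ∃ (m : ℤ) (c : Fin N) (V : Set X), V ∈ C m c ∧ x ∈ V ∧ P * m < f x ∧
          f x < P * (m + 1) ∧ W = Wc m V ∧ i = c.castSucc) ?_ ?_
      · rintro W ⟨⟨e', c, U, hU, rfl⟩ | ⟨m, c, V, hV, rfl⟩, hxW⟩
        · exact absurd ⟨e', hxW.2.2.trans (by rw [hb]; linarith [hcN c])⟩ hx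
        · exact ⟨_, m, c, V, hV, hxW.2.1, hxW.2.2.1, hxW.2.2.2.1, rfl, rfl⟩
      · rintro W W' i ⟨m, c, V, hV, hxV, h1, h2, rfl, rfl⟩ ⟨m', c', V', hV', hxV', h1', h2', rfl, hi⟩
        obtain rfl := Fin.castSucc_injective _ hi
        obtain rfl := huniq' x m m' h1 h2 h1' h2'
        rw [hCd m c V hV V' hV' x hxV hxV']
  · rintro W (⟨e, c, U, hU, rfl⟩ | ⟨m, c, V, hV, rfl⟩) x hx y hy
    · exact (hFm e c U hU x hx.2.1 y hy.2.1).trans (le_max_left _ _)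
    · exact (hCm m c V hV x hx.2.1 y hy.2.1).trans (le_max_right _ _)
  · intro x hx
    have hfy : ∀ y, dist x y ≤ r → f x - r ≤ f y ∧ f y ≤ f x + r := fun y hy => by
      have := abs_le.mp ((hf x y).trans hy)
      constructor <;> linarith
    by_cases hxe : ∃ e : ℤ, |f x - P * e| ≤ b + r
    · obtain ⟨e, he⟩ := hxe
      obtain ⟨c, U, hU, hUy⟩ := hFl e x ⟨hx, he.trans (by linarith)⟩
      have he' := abs_le.mp he
      have hyU : ∀ y ∈ A, dist x y ≤ r → y ∈ U := fun y hy hd => hUy y ⟨hy, by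
        have := hfy y hd
        simp only [Set.mem_ofPred_eq, abs_le]
        constructor <;> linarith⟩ hd
      by_cases hc : |f x - P * e| ≤ 3 * (((c : ℕ) + 1 : ℝ) * r)
      · refine ⟨Wf e c U, Or.inl ⟨e, c, U, hU, rfl⟩, fun y hy hd => ⟨hy, hyU y hy hd, ?_⟩⟩
        have := hfy y hd
        rw [abs_le] at hc ⊢
        constructor <;> linarith
      · push Not at hc
        have hcr := hc0 c
        obtain ⟨m, hm⟩ : ∃ m : ℤ, ∀ y, dist x y ≤ r → P * m < f y ∧ f y < P * (m + 1) ∧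
            3 * (((c : ℕ) + 1 : ℝ) * r) - r ≤ |f y - P * e| ∧
            (|f y - P * e| ≤ b ∨ (b < f y - P * m ∧ b < P * (m + 1) - f y)) := by
          rcases lt_abs.mp hc with h | h
          · refine ⟨e, fun y hd => ?_⟩
            have := hfy y hd
            have hP1 : P * ((e : ℝ) + 1) = P * e + P := by ring
            rw [abs_of_pos (by linarith), hP1]
            refine ⟨by linarith, by linarith, by linarith, ?_⟩
            rcases le_or_gt (f y - P * e) b with h' | h'
            · exact Or.inl h'
            · exact Or.inr ⟨h', by linarith⟩
          · refine ⟨e - 1, fun y hd => ?_⟩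
            have := hfy y hd
            have hP1 : P * (((e - 1 : ℤ) : ℝ) + 1) = P * e := by push_cast; ring
            have hP2 : P * ((e - 1 : ℤ) : ℝ) = P * e - P := by push_cast; ring
            rw [abs_of_neg (by linarith), hP1, hP2]
            refine ⟨by linarith, by linarith, by linarith, ?_⟩
            rcases le_or_gt (-(f y - P * e)) b with h' | h'
            · exact Or.inl h'
            · exact Or.inr ⟨by linarith, by linarith⟩
        have hxx : dist x x ≤ r := by rw [dist_self]; exact hr.le
        have hmx := hm x hxx
        obtain ⟨⟨c', hV⟩, hVy⟩ := hπ m e U ⟨c, hU⟩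
          ⟨x, hyU x hx hxx, hx, hmx.1.le, hmx.2.1.le⟩
        refine ⟨Wc m (π m e U), Or.inr ⟨m, c', _, hV, rfl⟩, fun y hy hd => ?_⟩
        obtain ⟨h1, h2, h3, h4⟩ := hm y hd
        refine ⟨hy, hVy y (hyU y hy hd) hy h1.le h2.le, h1, h2, ?_⟩
        rcases h4 with h4 | h4
        · exact Or.inr ⟨e, h4, c, U, hU, hyU y hy hd, h3, rfl⟩
        · exact Or.inl h4
    · push Not at hxe
      set m : ℤ := ⌊f x / P⌋ with hm
      have h1 : P * m ≤ f x := by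
        have := Int.floor_le (f x / P)
        rw [le_div_iff₀ hP0] at this
        linarith
      have h2 : f x < P * (m + 1) := by
        have := Int.lt_floor_add_one (f x / P)
        rw [div_lt_iff₀ hP0] at this
        linarith
      have h3 := hxe m
      have h4 := hxe (m + 1)
      push_cast at h4
      rw [abs_of_nonneg (by linarith)] at h3
      rw [abs_of_neg (by linarith)] at h4
      obtain ⟨c, V, hV, hVy⟩ := hCl m x ⟨hx, by
        simp only [Set.mem_ofPred_eq, abs_le]; constructor <;> linarith⟩
      refine ⟨Wc m V, Or.inr ⟨m, c, V, hV, rfl⟩, fun y hy hd => ?_⟩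
      have := hfy y hd
      refine ⟨hy, hVy y ⟨hy, ?_⟩ (hd.trans (le_max_right _ _)), by linarith, by linarith,
        Or.inl ⟨by linarith, by linarith⟩⟩
      simp only [Set.mem_ofPred_eq, abs_le]; constructor <;> linarith

/-- A Hurewicz-type theorem for maps to the line: if the strips of a `1`-Lipschitz function on the
members of a family admit `N`-colored covers uniformly, then the members of the family admit
covers of multiplicity `N + 1` uniformly. -/
lemma hasMultCover_of_strips {X : Type*} [PseudoMetricSpace X] {𝒜 : Set (Set X)} {f : X → ℝ}
    (hf : ∀ x y, |f x - f y| ≤ dist x y) {N : ℕ}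
    (h : ∀ r L : ℝ, 0 < r → 0 < L →
      ∃ D, ∀ A ∈ 𝒜, ∀ t, HasColoredCover (A ∩ {x | |f x - t| ≤ L}) r D N)
    {r : ℝ} (hr : 0 < r) :
    ∃ D, ∀ A ∈ 𝒜, HasMultCover A r D (N + 1) := by
  have hP : 0 < (6 * N + 10) * r := by positivity
  obtain ⟨D, hD⟩ := h r _ hr hP
  obtain ⟨D', hD'⟩ := h (max D r) _ (lt_max_of_lt_right hr) hP
  exact ⟨max D D', fun A hA => hasMultCover_of_strips_aux hf hr rfl (hD A hA) (hD' A hA)⟩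

/-! ### Passing between covers at a scale, Lebesgue numbers and asymptotic dimension -/

lemma exists_mem_of_lt_lebesgueF {Z : Type*} [PseudoMetricSpace Z] {U : Set (Set Z)} {A : Set Z}
    {L ε : ℝ} (hL : 0 < L) (hε : ε < L) (h : ENNReal.ofReal L ≤ lebesgueF U A) {z : Z}
    (hz : z ∈ A) : ∃ V ∈ U, ∀ w, dist z w ≤ ε → w ∈ V := by
  have h1 : ENNReal.ofReal ε < ⨆ V ∈ U, Metric.infEDist z Vᶜ :=
    ((ENNReal.ofReal_lt_ofReal_iff hL).2 hε).trans_le (h.trans (iInf₂_le z hz))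
  simp only [lt_iSup_iff] at h1
  obtain ⟨V, hV, h2⟩ := h1
  refine ⟨V, hV, fun w hw => ?_⟩
  by_contra hwV
  have h3 : Metric.infEDist z Vᶜ ≤ edist z w := Metric.infEDist_le_edist_of_mem hwV
  rw [edist_dist] at h3
  exact absurd h2 (not_lt.2 (h3.trans (ENNReal.ofReal_le_ofReal hw)))

lemma dist_le_of_meshF_le {Z : Type*} [PseudoMetricSpace Z] {U : Set (Set Z)} {M : ℝ}
    (hM : 0 ≤ M) (h : meshF U ≤ ENNReal.ofReal M) {V : Set Z} (hV : V ∈ U) {z w : Z}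
    (hz : z ∈ V) (hw : w ∈ V) : dist z w ≤ M := by
  have h1 : Metric.ediam V ≤ meshF U := le_iSup₂ (f := fun V (_ : V ∈ U) => Metric.ediam V) V hV
  have h2 : edist z w ≤ ENNReal.ofReal M := (Metric.edist_le_ediam_of_mem hz hw).trans (h1.trans h)
  rwa [edist_dist, ENNReal.ofReal_le_ofReal_iff hM] at h2

lemma asdimLE_of_hasMultCover {X : Type*} [PseudoMetricSpace X] {m : ℕ}
    (h : ∀ r : ℝ, 0 < r → ∃ D, HasMultCover (Set.univ : Set X) r D (m + 1)) : AsdimLE X m := by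
  intro d hd
  obtain ⟨D, F, hmult, hmesh, hleb⟩ := h d hd
  have hball : ∀ x : X, ∃ U ∈ F, ball x d ⊆ interior U := fun x => by
    obtain ⟨U, hU, hUy⟩ := hleb x (Set.mem_univ x)
    exact ⟨U, hU, interior_maximal (fun y hy => hUy y (Set.mem_univ y)
      (by rw [dist_comm]; exact (mem_ball.1 hy).le)) isOpen_ball⟩
  refine ⟨interior '' F, ?_, ?_, ?_, ?_, ?_⟩
  · rintro _ ⟨U, -, rfl⟩
    exact isOpen_interior
  · intro x _
    obtain ⟨U, hU, hxU⟩ := hball x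
    exact ⟨_, ⟨U, hU, rfl⟩, hxU (mem_ball_self hd)⟩
  · rintro s hs ⟨x, hx⟩
    obtain ⟨hfin, hcard⟩ := hmult x
    have hsub : (s : Set (Set X)) ⊆ interior '' {U ∈ F | x ∈ U} := by
      intro V hV
      obtain ⟨U, hU, rfl⟩ := hs hV
      exact ⟨U, ⟨hU, interior_subset (hx _ hV)⟩, rfl⟩
    have h1 := Set.ncard_le_ncard hsub (hfin.image _)
    rw [Set.ncard_coe_finset] at h1
    exact (h1.trans (Set.ncard_image_le hfin)).trans hcard
  · refine lt_of_le_of_lt ?_ (ENNReal.ofReal_lt_top (r := D))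
    refine iSup₂_le ?_
    rintro _ ⟨U, hU, rfl⟩
    refine Metric.ediam_le fun x hx y hy => ?_
    rw [edist_dist]
    exact ENNReal.ofReal_le_ofReal (hmesh U hU x (interior_subset hx) y (interior_subset hy))
  · refine le_iInf₂ fun x _ => ?_
    obtain ⟨U, hU, hxU⟩ := hball x
    refine le_trans ?_ (le_iSup₂ (f := fun V (_ : V ∈ interior '' F) => Metric.infEDist x Vᶜ)
      (interior U) ⟨U, hU, rfl⟩)
    refine Metric.le_infEDist.2 fun y hy => ?_
    by_contra! hlt
    rw [edist_dist, ENNReal.ofReal_lt_ofReal_iff hd, dist_comm] at hlt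
    exact hy (hxU hlt)

/-! ### Strips of hyperbolic cones -/

lemma PaperDefs.IsHypCone.cosh_dist {Z C : Type*} [PseudoMetricSpace Z] [PseudoMetricSpace C]
    {h : Z × ℝ≥0 → C} (hc : IsHypCone Z C h) (p q : Z × ℝ≥0) :
    Real.cosh (dist (h p) (h q)) = Real.cosh (p.2 - q.2) + Real.sinh p.2 * Real.sinh q.2 *
      (1 - Real.cos (Real.pi / Metric.diam (Set.univ : Set Z) * dist p.1 q.1)) := by
  have hs : 0 ≤ Real.sinh p.2 * Real.sinh q.2 :=
    mul_nonneg (Real.sinh_nonneg_iff.2 p.2.2) (Real.sinh_nonneg_iff.2 q.2.2)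
  have h1 := mul_nonneg hs (sub_nonneg.2
    (Real.cos_le_one (Real.pi / Metric.diam (Set.univ : Set Z) * dist p.1 q.1)))
  have h2 := Real.one_le_cosh ((p.2 : ℝ) - q.2)
  have h3 := Real.cosh_sub (p.2 : ℝ) q.2
  rw [hc.2, show coneDist p q = Real.arcosh _ from rfl, Real.cosh_arcosh (by linarith)]
  rw [h3]; ring

/-- A hyperbolic cone carries a `1`-Lipschitz height function, and the part of the cone at height
about `t` looks, at bounded scales, like a rescaling of the base by a factor of at least `1`. -/
lemma PaperDefs.IsHypCone.exists_height {Z C : Type*} [PseudoMetricSpace Z] [PseudoMetricSpace C]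
    {h : Z × ℝ≥0 → C} (hc : IsHypCone Z C h) (hb : Bornology.IsBounded (Set.univ : Set Z))
    (hd : 0 < Metric.diam (Set.univ : Set Z)) :
    ∃ ρ : C → ℝ, (∀ x y, |ρ x - ρ y| ≤ dist x y) ∧
      ∀ r L η τ : ℝ, 0 ≤ r → 0 ≤ L → 0 < η → 0 ≤ τ → ∃ D, ∀ t : ℝ, ∃ a : ℝ≥0, 1 ≤ a ∧
        ∃ φ : C → Z, ∀ x y, |ρ x - t| ≤ L → |ρ y - t| ≤ L →
          (dist x y ≤ r → a * dist (φ x) (φ y) ≤ η) ∧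
          (a * dist (φ x) (φ y) ≤ τ → dist x y ≤ D) := by
  choose p hp using hc.1
  set μ : ℝ := Real.pi / Metric.diam (Set.univ : Set Z) with hμ
  have hμ0 : 0 < μ := div_pos Real.pi_pos hd
  have hcosh : ∀ x y, Real.cosh (dist x y) = Real.cosh ((p x).2 - (p y).2) +
      Real.sinh (p x).2 * Real.sinh (p y).2 * (1 - Real.cos (μ * dist (p x).1 (p y).1)) :=
    fun x y => by rw [← hc.cosh_dist, hp, hp]
  have hsinh : ∀ x, 0 ≤ Real.sinh (p x).2 := fun x => Real.sinh_nonneg_iff.2 (p x).2.2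
  have hθ : ∀ x y, |μ * dist (p x).1 (p y).1| ≤ Real.pi := fun x y => by
    rw [abs_of_nonneg (by positivity)]
    have h1 : dist (p x).1 (p y).1 ≤ Metric.diam (Set.univ : Set Z) :=
      Metric.dist_le_diam_of_mem hb (Set.mem_univ _) (Set.mem_univ _)
    calc μ * dist (p x).1 (p y).1 ≤ μ * Metric.diam (Set.univ : Set Z) := by gcongr
      _ = Real.pi := by rw [hμ]; field_simp
  refine ⟨fun x => (p x).2, fun x y => ?_, ?_⟩
  · have h1 : Real.cosh ((p x).2 - (p y).2) ≤ Real.cosh (dist x y) := by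
      rw [hcosh]
      have := mul_nonneg (mul_nonneg (hsinh x) (hsinh y))
        (sub_nonneg.2 (Real.cos_le_one (μ * dist (p x).1 (p y).1)))
      linarith
    rwa [Real.cosh_le_cosh, abs_of_nonneg (dist_nonneg (x := x))] at h1
  intro r L η τ hr hL hη hτ
  obtain ⟨z₀⟩ : Nonempty Z := by
    by_contra hne
    rw [not_nonempty_iff] at hne
    rw [Set.univ_eq_empty_iff.2 hne, Metric.diam_empty] at hd
    exact lt_irrefl _ hd
  set K : ℝ := 8 * Real.pi ^ 2 * Real.exp L ^ 2 * Real.cosh r / μ ^ 2 with hK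
  have hK0 : 0 < K := by
    have := Real.pi_pos
    have := Real.cosh_pos r
    positivity
  set κ : ℝ := η / √K with hκ
  have hκ0 : 0 < κ := div_pos hη (Real.sqrt_pos.2 hK0)
  set T : ℝ := max (L + 1) (-Real.log κ) with hT
  set B : ℝ := Real.cosh (2 * L) + Real.exp L ^ 2 * μ ^ 2 * (τ / κ) ^ 2 / 8 with hB
  refine ⟨max (2 * B) (2 * (T + L)), fun t => ?_⟩
  by_cases ht : t < T
  · refine ⟨1, le_rfl, fun _ => z₀, fun x y hx hy => ⟨fun _ => by simpa using hη.le, fun _ => ?_⟩⟩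
    refine le_trans ?_ (le_max_right _ _)
    rw [abs_le] at hx hy
    have h1 : Real.cosh (dist x y) ≤ Real.cosh ((p x).2 + (p y).2) := by
      rw [hcosh, Real.cosh_sub, Real.cosh_add]
      nlinarith [mul_nonneg (hsinh x) (hsinh y), Real.neg_one_le_cos (μ * dist (p x).1 (p y).1)]
    rw [Real.cosh_le_cosh, abs_of_nonneg dist_nonneg, abs_of_nonneg (by positivity)] at h1
    linarith
  push Not at ht
  have htL : L + 1 ≤ t := (le_max_left _ _).trans ht
  have htκ : 1 ≤ κ * Real.exp t := by
    rw [← Real.exp_log hκ0, ← Real.exp_add]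
    exact Real.one_le_exp (by linarith [(le_max_right (L + 1) (-Real.log κ)).trans ht])
  refine ⟨NNReal.mk (κ * Real.exp t) (by positivity), htκ, fun x => (p x).1, fun x y hx hy => ?_⟩
  simp only [NNReal.coe_mk] at hx hy ⊢
  set s := dist (p x).1 (p y).1 with hs
  have hs0 : 0 ≤ s := dist_nonneg
  have hxy := hcosh x y
  have hsx := hsinh x
  have hsy := hsinh y
  have hθxy := hθ x y
  rw [← hs] at hxy hθxy
  set u : ℝ := ((p x).2 : ℝ)
  set v : ℝ := ((p y).2 : ℝ)
  rw [abs_le] at hx hy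
  constructor
  · intro hdist
    have hlow : ∀ w : ℝ, t - L ≤ w → Real.exp (t - L) / 4 ≤ Real.sinh w := fun w hw => by
      have h1 : Real.exp (t - L) ≤ Real.exp w := Real.exp_le_exp.2 hw
      have h2 : 2 ≤ Real.exp w := by linarith [Real.add_one_le_exp w]
      have h3 : Real.exp (-w) ≤ 1 / 2 := by
        rw [Real.exp_neg, inv_eq_one_div]
        exact one_div_le_one_div_of_le two_pos h2
      rw [Real.sinh_eq]
      linarith
    have h1 : Real.cosh (dist x y) ≤ Real.cosh r := by
      rwa [Real.cosh_le_cosh, abs_of_nonneg dist_nonneg, abs_of_nonneg hr]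
    have h2 : 2 / Real.pi ^ 2 * (μ * s) ^ 2 ≤ 1 - Real.cos (μ * s) := by
      linarith [Real.cos_le_one_sub_mul_cos_sq hθxy]
    have h3 : Real.exp (t - L) / 4 * (Real.exp (t - L) / 4) * (2 / Real.pi ^ 2 * (μ * s) ^ 2) ≤
        Real.cosh r := by
      calc _ ≤ Real.sinh u * Real.sinh v * (1 - Real.cos (μ * s)) := by
            gcongr
            · exact hlow u (by linarith)
            · exact hlow v (by linarith)
        _ ≤ Real.cosh r := by linarith [Real.one_le_cosh (u - v)]
    have h4 : (Real.exp t * s) ^ 2 ≤ K := by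
      rw [hK, le_div_iff₀ (by positivity)]
      rw [Real.exp_sub] at h3
      have hL0 := Real.exp_pos L
      have hπ := Real.pi_pos
      have h5 : (Real.exp t * s) ^ 2 * μ ^ 2 = 8 * Real.pi ^ 2 * Real.exp L ^ 2 *
          (Real.exp t / Real.exp L / 4 * (Real.exp t / Real.exp L / 4) *
            (2 / Real.pi ^ 2 * (μ * s) ^ 2)) := by
        field_simp
        ring
      rw [h5]
      gcongr
    have h5 := Real.le_sqrt_of_sq_le h4
    calc κ * Real.exp t * s = κ * (Real.exp t * s) := by ring
      _ ≤ κ * √K := by gcongr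
      _ = η := by rw [hκ]; have := Real.sqrt_pos.2 hK0; field_simp
  · intro hτs
    refine le_trans ?_ (le_max_left _ _)
    have hup : ∀ w : ℝ, w ≤ t + L → Real.sinh w ≤ Real.exp t * Real.exp L / 2 := fun w hw => by
      rw [← Real.exp_add, Real.sinh_eq]
      linarith [Real.exp_le_exp.2 hw, Real.exp_pos (-w)]
    have h1 : Real.exp t * s ≤ τ / κ := by
      rw [le_div_iff₀ hκ0]; linarith
    have h2 : 1 - Real.cos (μ * s) ≤ (μ * s) ^ 2 / 2 := by
      linarith [Real.one_sub_sq_div_two_le_cos (x := μ * s)]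
    have h3 : Real.cosh (u - v) ≤ Real.cosh (2 * L) := by
      rw [Real.cosh_le_cosh, abs_of_nonneg (by linarith : 0 ≤ 2 * L), abs_le]
      constructor <;> linarith
    have h4 : Real.sinh u * Real.sinh v * (1 - Real.cos (μ * s)) ≤
        Real.exp L ^ 2 * μ ^ 2 * (τ / κ) ^ 2 / 8 := by
      calc _ ≤ (Real.exp t * Real.exp L / 2) * (Real.exp t * Real.exp L / 2) *
            ((μ * s) ^ 2 / 2) := by
            gcongr
            · linarith [Real.cos_le_one (μ * s)]
            · exact hup u (by linarith)
            · exact hup v (by linarith)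
        _ = Real.exp L ^ 2 * μ ^ 2 * (Real.exp t * s) ^ 2 / 8 := by ring
        _ ≤ _ := by gcongr
    have h5 : Real.exp (dist x y) / 2 ≤ Real.cosh (dist x y) := by
      rw [Real.cosh_eq]
      linarith [Real.exp_pos (-dist x y)]
    linarith [Real.add_one_le_exp (dist x y)]

lemma HasColoredCover.mono {X : Type*} [PseudoMetricSpace X] {A B : Set X} {r D : ℝ} {N : ℕ}
    (h : HasColoredCover B r D N) (hAB : A ⊆ B) : HasColoredCover A r D N := by
  obtain ⟨F, hd, hm, hl⟩ := h
  refine ⟨F, hd, hm, fun x hx => ?_⟩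
  obtain ⟨c, U, hU, hUy⟩ := hl x (hAB hx)
  exact ⟨c, U, hU, fun y hy => hUy y (hAB hy)⟩

/-- Colored covers pull back along maps that are controlled on `A` in both directions. -/
lemma hasColoredCover_of_preimage {X Y : Type*} [PseudoMetricSpace X] [PseudoMetricSpace Y]
    {A : Set X} {r D τ ε : ℝ} {N : ℕ} {U : Set (Set Y)} {F : Fin N → Set (Set Y)}
    (hUF : U = ⋃ i, F i) (hF : ∀ i, (F i).Pairwise Disjoint)
    (hmesh : ∀ V ∈ U, ∀ z ∈ V, ∀ w ∈ V, dist z w ≤ τ)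
    (hleb : ∀ z, ∃ V ∈ U, ∀ w, dist z w ≤ ε → w ∈ V) {φ : X → Y}
    (hφ : ∀ x ∈ A, ∀ y ∈ A, dist x y ≤ r → dist (φ x) (φ y) ≤ ε)
    (hφ' : ∀ x ∈ A, ∀ y ∈ A, dist (φ x) (φ y) ≤ τ → dist x y ≤ D) :
    HasColoredCover A r D N := by
  subst hUF
  refine ⟨fun c => (fun V => A ∩ φ ⁻¹' V) '' F c, ?_, ?_, ?_⟩
  · rintro c _ ⟨V, hV, rfl⟩ _ ⟨V', hV', rfl⟩ x hx hx'
    by_cases h : V = V'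
    · rw [h]
    · exact absurd hx'.2 (Set.disjoint_left.1 (hF c hV hV' h) hx.2)
  · rintro c _ ⟨V, hV, rfl⟩ x hx y hy
    exact hφ' x hx.1 y hy.1 (hmesh V (Set.mem_iUnion.2 ⟨c, hV⟩) _ hx.2 _ hy.2)
  · intro x hx
    obtain ⟨V, hV, hVw⟩ := hleb (φ x)
    obtain ⟨c, hc⟩ := Set.mem_iUnion.1 hV
    exact ⟨c, _, ⟨V, hc, rfl⟩, fun y hy hxy => ⟨hy, hVw _ (hφ x hx y hy hxy)⟩⟩

/-- **Proposition (asprod<).** If `Z₁`, `Z₂` are bounded metric spaces (of positive diameter)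
such that the family `{a Z₁ × b Z₂ : a, b ≥ 1}` has `ℓ-dim ≤ k` uniformly, then
`asdim (Co Z₁ × Co Z₂) ≤ k + 2`. -/
theorem asdim_cone_prod_le
    {Z₁ Z₂ : Type*} [MetricSpace Z₁] [MetricSpace Z₂]
    (hb₁ : Bornology.IsBounded (Set.univ : Set Z₁))
    (hb₂ : Bornology.IsBounded (Set.univ : Set Z₂))
    (hd₁ : 0 < Metric.diam (Set.univ : Set Z₁))
    (hd₂ : 0 < Metric.diam (Set.univ : Set Z₂))
    (k : ℕ)
    (hfam : UnifElldimLE (fun p : {p : ℝ≥0 × ℝ≥0 // 1 ≤ p.1 ∧ 1 ≤ p.2} =>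
      Scaled p.1.1 Z₁ × Scaled p.1.2 Z₂) k)
    (C₁ C₂ : Type*) [MetricSpace C₁] [MetricSpace C₂]
    (h₁ : Z₁ × ℝ≥0 → C₁) (h₂ : Z₂ × ℝ≥0 → C₂)
    (hc₁ : IsHypCone Z₁ C₁ h₁) (hc₂ : IsHypCone Z₂ C₂ h₂) :
    asdim (C₁ × C₂) ≤ (k : ℕ∞) + 2 := by
  obtain ⟨ρ₁, hρ₁, hs₁⟩ := hc₁.exists_height hb₁ hd₁
  obtain ⟨ρ₂, hρ₂, hs₂⟩ := hc₂.exists_height hb₂ hd₂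
  obtain ⟨δ, ⟨hδ0, -⟩, τ₀, hτ₀, hcov⟩ := hfam
  have hbase : ∀ r L : ℝ, 0 < r → 0 < L → ∃ D, ∀ t₁ t₂ : ℝ, HasColoredCover
      ({x : C₁ × C₂ | |ρ₂ x.2 - t₂| ≤ L} ∩ {x | |ρ₁ x.1 - t₁| ≤ L}) r D (k + 1) := by
    intro r L hr hL
    have hτ : 0 < τ₀ / 2 := by linarith
    have hη : 0 < δ * (τ₀ / 2) := by positivity
    obtain ⟨D₁, hD₁⟩ := hs₁ r L (δ * (τ₀ / 2) / 2) (τ₀ / 2) hr.le hL.le (by linarith) hτ.le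
    obtain ⟨D₂, hD₂⟩ := hs₂ r L (δ * (τ₀ / 2) / 2) (τ₀ / 2) hr.le hL.le (by linarith) hτ.le
    refine ⟨max D₁ D₂, fun t₁ t₂ => ?_⟩
    obtain ⟨a₁, ha₁, φ₁, hφ₁⟩ := hD₁ t₁
    obtain ⟨a₂, ha₂, φ₂, hφ₂⟩ := hD₂ t₂
    obtain ⟨U, -, -, ⟨F, hUF, hF⟩, hmesh, hleb⟩ :=
      hcov (τ₀ / 2) hτ (by linarith) ⟨(a₁, a₂), ha₁, ha₂⟩
    exact hasColoredCover_of_preimage hUF hF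
      (fun V hV z hz w hw => dist_le_of_meshF_le hτ.le hmesh hV hz hw)
      (fun z => exists_mem_of_lt_lebesgueF hη (half_lt_self hη) hleb (Set.mem_univ z))
      (φ := fun x => (φ₁ x.1, φ₂ x.2))
      (fun x hx y hy hxy => max_le
        ((hφ₁ x.1 y.1 hx.2 hy.2).1 ((le_max_left _ _).trans hxy))
        ((hφ₂ x.2 y.2 hx.1 hy.1).1 ((le_max_right _ _).trans hxy)))
      (fun x hx y hy hxy => max_le_max
        ((hφ₁ x.1 y.1 hx.2 hy.2).2 ((le_max_left _ _).trans hxy))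
        ((hφ₂ x.2 y.2 hx.1 hy.1).2 ((le_max_right _ _).trans hxy)))
  have hstrip : ∀ r L : ℝ, 0 < r → 0 < L → ∃ D, ∀ t : ℝ, HasColoredCover
      {x : C₁ × C₂ | |ρ₂ x.2 - t| ≤ L} r D (k + 2) := by
    intro r L hr hL
    have hN : (0 : ℝ) < 2 * ((k + 2 : ℕ) : ℝ) + 1 := by positivity
    obtain ⟨D, hD⟩ := hasMultCover_of_strips
      (𝒜 := Set.range fun t : ℝ => {x : C₁ × C₂ | |ρ₂ x.2 - t| ≤ L}) (f := fun x => ρ₁ x.1)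
      (N := k + 1) (fun x y => (hρ₁ _ _).trans (le_max_left _ _)) (fun r' L' hr' hL' => by
        obtain ⟨D, hD⟩ := hbase r' (max L L') hr' (lt_max_of_lt_left hL)
        refine ⟨D, ?_⟩
        rintro _ ⟨t, rfl⟩ t'
        exact (hD t' t).mono (Set.inter_subset_inter
          (fun x hx => (show |ρ₂ x.2 - t| ≤ L from hx).trans (le_max_left _ _))
          (fun x hx => (show |ρ₁ x.1 - t'| ≤ L' from hx).trans (le_max_right _ _))))
      (mul_pos hr hN)
    refine ⟨D, fun t => ?_⟩
    have := (hD _ ⟨t, rfl⟩).hasColoredCover (mul_pos hr hN).le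
    rwa [mul_div_cancel_right₀ _ hN.ne'] at this
  have hasd : AsdimLE (C₁ × C₂) (k + 2) := asdimLE_of_hasMultCover fun r hr => by
    obtain ⟨D, hD⟩ := hasMultCover_of_strips (𝒜 := {(Set.univ : Set (C₁ × C₂))})
      (f := fun x => ρ₂ x.2) (N := k + 2) (fun x y => (hρ₂ _ _).trans (le_max_right _ _))
      (fun r' L' hr' hL' => by
        obtain ⟨D, hD⟩ := hstrip r' L' hr' hL'
        refine ⟨D, ?_⟩
        rintro _ rfl t
        rw [Set.univ_inter]
        exact hD t) hr
    exact ⟨D, hD _ rfl⟩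
  exact sInf_le ⟨k + 2, by push_cast; rfl, hasd⟩
end
end

section
/- Let Z be a bounded metric space of positive diameter. Then ℓ-asdim(Co(Z)) ≤ ℓ-dim(Z × [0,1]), where Co(Z) is the hyperbolic cone over Z and Z × [0,1] carries the l∞ metric. -/
open Metric Set Filter ENNReal NNReal

noncomputable section

open PaperDefs

/-- Saturated union of two coloured families: every member of the coarse family `G` absorbs the
members of the fine family `F` that reach into its core. -/
theorem exists_saturated_union {Y : Type*} {m : ℕ} (F G : Fin m → Set (Set Y))
    (hF : ∀ i, (F i).Pairwise Disjoint) (hG : ∀ i, (G i).Pairwise Disjoint)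
    (E : Y → Y → Prop) (hE : ∀ i, ∀ U ∈ F i, ∀ x ∈ U, ∀ y ∈ U, E x y) :
    ∃ W : Fin m → Set (Set Y), (∀ i, (W i).Pairwise Disjoint) ∧
      (∀ i, ∀ w ∈ W i, w ∈ F i ∨ ∃ V ∈ G i, w ⊆ V) ∧
      (∀ i, ∀ U ∈ F i, ∃ w ∈ W i, U ⊆ w) ∧
      (∀ i, ∀ V ∈ G i, ∃ w ∈ W i, ∀ x ∈ V, (∀ y, E x y → y ∈ V) → x ∈ w) := by
  let core : Set Y → Set Y := fun V => {x | x ∈ V ∧ ∀ y, E x y → y ∈ V}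
  let sat : Fin m → Set Y → Set Y := fun i V => core V ∪ ⋃₀ {U ∈ F i | (U ∩ core V).Nonempty}
  have sat_sub : ∀ i V, sat i V ⊆ V := by
    rintro i V x (hx | ⟨U, ⟨hU, y, hyU, hy⟩, hxU⟩)
    · exact hx.1
    · exact hy.2 x (hE i U hU y hyU x hxU)
  have sat_disj : ∀ i V, ∀ U ∈ F i, Disjoint U (core V) → Disjoint U (sat i V) := by
    intro i V U hU hd
    rw [Set.disjoint_left] at hd ⊢
    rintro x hx (hx' | ⟨U', ⟨hU', y, hyU, hy⟩, hxU⟩)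
    · exact hd hx hx'
    · rcases eq_or_ne U U' with rfl | hne
      · exact hd hyU hy
      · exact Set.disjoint_left.1 (hF i hU hU' hne) hx hxU
  refine ⟨fun i => sat i '' G i ∪ {U ∈ F i | ∀ V ∈ G i, Disjoint U (core V)}, ?_, ?_, ?_, ?_⟩
  · rintro i _ (⟨V, hV, rfl⟩ | ⟨hU, hUd⟩) _ (⟨V', hV', rfl⟩ | ⟨hU', hUd'⟩) hne
    · exact (hG i hV hV' (fun h => hne (by rw [h]))).mono (sat_sub i V) (sat_sub i V')
    · exact (sat_disj i V _ hU' (hUd' V hV)).symm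
    · exact sat_disj i V' _ hU (hUd V' hV')
    · exact hF i hU hU' hne
  · rintro i _ (⟨V, hV, rfl⟩ | ⟨hU, -⟩)
    · exact Or.inr ⟨V, hV, sat_sub i V⟩
    · exact Or.inl hU
  · intro i U hU
    by_cases h : ∀ V ∈ G i, Disjoint U (core V)
    · exact ⟨U, Or.inr ⟨hU, h⟩, subset_rfl⟩
    · push Not at h
      obtain ⟨V, hV, hn⟩ := h
      rw [Set.not_disjoint_iff_nonempty_inter] at hn
      exact ⟨sat i V, Or.inl ⟨V, hV, rfl⟩, fun x hx => Or.inr ⟨U, ⟨hU, hn⟩, hx⟩⟩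
  · intro i V hV
    exact ⟨sat i V, Or.inl ⟨V, hV, rfl⟩, fun x hx hx' => Or.inl ⟨hx, hx'⟩⟩

/-- Slabs `Z × [a, a')` of height at most `q / p`, with `p < τ₀`, have `k + 1`-coloured coverings
with mesh `p` in the direction of `Z` and `q` in the radial direction, and with Lebesgue numbers
`ε p` and `ε q` in these directions. -/
def HasSlabFamilies (Z : Type*) [MetricSpace Z] (k : ℕ) (ε τ₀ : ℝ) : Prop :=
  ∀ p q a a' : ℝ, 0 < p → p < τ₀ → 0 < q → a' - a ≤ q / p →
    ∃ F : Fin (k + 1) → Set (Set (Z × ℝ≥0)),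
      (∀ i, (F i).Pairwise Disjoint) ∧
      (∀ i, ∀ V ∈ F i, ∀ x ∈ V, a ≤ x.2 ∧ x.2 < a') ∧
      (∀ i, ∀ V ∈ F i, ∀ x ∈ V, ∀ y ∈ V, |(x.2 : ℝ) - y.2| ≤ q ∧ dist x.1 y.1 ≤ p) ∧
      (∀ x : Z × ℝ≥0, a + ε * q ≤ x.2 → x.2 + ε * q < a' → ∃ i, ∃ V ∈ F i,
        ∀ y : Z × ℝ≥0, |(x.2 : ℝ) - y.2| ≤ ε * q → dist x.1 y.1 ≤ ε * p → y ∈ V)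

theorem exists_hasSlabFamilies {Z : Type*} [MetricSpace Z] {k : ℕ}
    (hk : ElldimLE (Z × Set.Icc (0 : ℝ) 1) k) :
    ∃ ε : ℝ, 0 < ε ∧ ∃ τ₀ : ℝ, 0 < τ₀ ∧ HasSlabFamilies Z k ε τ₀ := by
  obtain ⟨δ, ⟨hδ0, -⟩, τ₀, hτ₀, hcov⟩ := hk
  refine ⟨δ / 2, by positivity, τ₀, hτ₀, fun p q a a' hp hpτ hq haa => ?_⟩
  obtain ⟨U, -, -, ⟨F, rfl, hF⟩, hmesh, hleb⟩ := hcov p hp hpτ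
  let s : ℝ → ℝ := fun t => (t - a) * (p / q)
  let g : Z × ℝ≥0 → Z × Set.Icc (0 : ℝ) 1 := fun x => (x.1, Set.projIcc 0 1 zero_le_one (s x.2))
  have hpq : 0 < p / q := by positivity
  have hs : ∀ t : ℝ, a ≤ t → t < a' → s t ∈ Set.Icc (0 : ℝ) 1 := by
    intro t h1 h2
    refine ⟨mul_nonneg (by linarith) hpq.le, ?_⟩
    calc (t - a) * (p / q) ≤ (q / p) * (p / q) :=
          mul_le_mul_of_nonneg_right (by linarith) hpq.le
      _ = 1 := by field_simp
  have hg : ∀ x y : Z × ℝ≥0, (a ≤ x.2 ∧ x.2 < a') → (a ≤ y.2 ∧ y.2 < a') →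
      dist (g x) (g y) = max (dist x.1 y.1) (|(x.2 : ℝ) - y.2| * (p / q)) := by
    intro x y hx hy
    have : dist (g x).2 (g y).2 = |(x.2 : ℝ) - y.2| * (p / q) := by
      simp only [g]
      rw [Set.projIcc_of_mem _ (hs _ hx.1 hx.2), Set.projIcc_of_mem _ (hs _ hy.1 hy.2),
        Subtype.dist_eq, Real.dist_eq]
      simp only [s]
      rw [← sub_mul, abs_mul, abs_of_pos hpq]
      congr 2
      ring
    rw [Prod.dist_eq, this]
  refine ⟨fun i => (fun V => {x | g x ∈ V ∧ a ≤ x.2 ∧ x.2 < a'}) '' F i, ?_, ?_, ?_, ?_⟩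
  · rintro i _ ⟨V, hV, rfl⟩ _ ⟨V', hV', rfl⟩ hne
    have := hF i hV hV' (fun h => hne (by rw [h]))
    rw [Set.disjoint_left] at this ⊢
    exact fun x hx hx' => this hx.1 hx'.1
  · rintro i _ ⟨V, hV, rfl⟩ x hx
    exact hx.2
  · rintro i _ ⟨V, hV, rfl⟩ x hx y hy
    have h1 : Metric.ediam V ≤ ENNReal.ofReal p :=
      (le_iSup₂ (f := fun V (_ : V ∈ ⋃ i, F i) => Metric.ediam V) V
        (Set.mem_iUnion.2 ⟨i, hV⟩)).trans hmesh
    have h2 : dist (g x) (g y) ≤ p := by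
      have := (Metric.edist_le_ediam_of_mem hx.1 hy.1).trans h1
      rwa [edist_dist, ENNReal.ofReal_le_ofReal_iff hp.le] at this
    rw [hg x y hx.2 hy.2, max_le_iff] at h2
    refine ⟨?_, h2.1⟩
    have := h2.2
    rw [← mul_div_assoc, div_le_iff₀ hq, mul_comm p q] at this
    exact le_of_mul_le_mul_right this hp
  · intro x hx1 hx2
    have hεq : 0 < δ / 2 * q := by positivity
    have h1 : ENNReal.ofReal (δ / 2 * p) <
        ⨆ V ∈ ⋃ i, F i, Metric.infEDist (g x) Vᶜ := by
      refine lt_of_lt_of_le ?_ (hleb.trans (iInf₂_le (g x) (Set.mem_univ _)))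
      rw [ENNReal.ofReal_lt_ofReal_iff (by positivity)]
      nlinarith [mul_pos hδ0 hp]
    simp only [lt_iSup_iff, Set.mem_iUnion] at h1
    obtain ⟨V, ⟨i, hV⟩, hlt⟩ := h1
    refine ⟨i, _, ⟨V, hV, rfl⟩, fun y hy1 hy2 => ?_⟩
    have hy := abs_le.1 hy1
    have hya : a ≤ y.2 ∧ y.2 < a' := ⟨by linarith, by linarith⟩
    refine ⟨?_, hya⟩
    by_contra hn
    have h3 := hlt.trans_le (Metric.infEDist_le_edist_of_mem (x := g x) hn)
    rw [edist_dist, ENNReal.ofReal_lt_ofReal_iff_of_nonneg (by positivity),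
      hg x y ⟨by linarith, by linarith⟩ hya, lt_max_iff] at h3
    rcases h3 with h3 | h3
    · linarith
    · have : |(x.2 : ℝ) - y.2| * (p / q) ≤ δ / 2 * q * (p / q) :=
        mul_le_mul_of_nonneg_right hy1 hpq.le
      have h4 : δ / 2 * q * (p / q) = δ / 2 * p := by field_simp
      linarith

/-- Anisotropic closeness in `Z × [0, ∞)`: distance at most `a` in the radial direction and at most
`b e^{-t}` in the direction of `Z`, where `t` is the height of the first point. -/
def Near {Z : Type*} [MetricSpace Z] (a b : ℝ) (x y : Z × ℝ≥0) : Prop :=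
  |(x.2 : ℝ) - y.2| ≤ a ∧ dist x.1 y.1 ≤ b * Real.exp (-x.2)

theorem Near.mono {Z : Type*} [MetricSpace Z] {a b a' b' : ℝ} {x y : Z × ℝ≥0}
    (h : Near a b x y) (ha : a ≤ a') (hb : b ≤ b') : Near a' b' x y :=
  ⟨h.1.trans ha, h.2.trans (mul_le_mul_of_nonneg_right hb (Real.exp_pos _).le)⟩

theorem Near.trans {Z : Type*} [MetricSpace Z] {a b a' b' : ℝ} {x y z : Z × ℝ≥0}
    (h : Near a b x y) (h' : Near a' b' y z) (hb' : 0 ≤ b') :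
    Near (a + a') (b + b' * Real.exp a) x z := by
  refine ⟨(abs_sub_le _ (y.2 : ℝ) _).trans (add_le_add h.1 h'.1), ?_⟩
  have h1 := abs_le.1 h.1
  have h2 : b' * Real.exp (-y.2) ≤ b' * (Real.exp a * Real.exp (-x.2)) := by
    rw [← Real.exp_add]
    exact mul_le_mul_of_nonneg_left (Real.exp_le_exp.2 (by linarith)) hb'
  calc dist x.1 z.1 ≤ dist x.1 y.1 + dist y.1 z.1 := dist_triangle _ _ _
    _ ≤ b * Real.exp (-x.2) + b' * (Real.exp a * Real.exp (-x.2)) :=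
        add_le_add h.2 (h'.2.trans h2)
    _ = _ := by ring

/-- Coverings of consecutive slabs of height `H` above height `r`. -/
theorem exists_layered_family {Z : Type*} [MetricSpace Z] {k : ℕ} {ε τ₀ : ℝ} (hε : 0 < ε)
    (hslab : HasSlabFamilies Z k ε τ₀)
    {r H d β : ℝ} (hH : 0 < H) (hd : 0 < d) (hβ : 0 < β)
    (h1 : β / ε * Real.exp (-r) < τ₀) (h2 : H * β * Real.exp (-r) ≤ d) :
    ∃ F : Fin (k + 1) → Set (Set (Z × ℝ≥0)),
      (∀ i, (F i).Pairwise Disjoint) ∧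
      (∀ i, ∀ V ∈ F i, ∀ x ∈ V, ∀ y ∈ V, Near (d / ε) (β / ε * Real.exp H) x y) ∧
      (∀ x : Z × ℝ≥0, ∀ j : ℕ, r + j * H + d ≤ x.2 → x.2 + d < r + (j + 1) * H →
        ∃ i, ∃ V ∈ F i, ∀ y, Near d β x y → y ∈ V) := by
  have hexp : ∀ j : ℕ, Real.exp (-(r + j * H)) ≤ Real.exp (-r) := fun j =>
    Real.exp_le_exp.2 (by have : 0 ≤ (j : ℝ) * H := by positivity
                          linarith)
  have key : ∀ j : ℕ, _ := fun j : ℕ => hslab (β / ε * Real.exp (-(r + j * H))) (d / ε)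
    (r + j * H) (r + (j + 1) * H) (by positivity)
    (lt_of_le_of_lt (mul_le_mul_of_nonneg_left (hexp j) (by positivity)) h1) (by positivity) (by
      rw [le_div_iff₀ (by positivity)]
      have h3 : H * β * Real.exp (-(r + j * H)) ≤ d :=
        (mul_le_mul_of_nonneg_left (hexp j) (by positivity)).trans h2
      calc (r + (j + 1) * H - (r + j * H)) * (β / ε * Real.exp (-(r + j * H)))
          = H * β * Real.exp (-(r + j * H)) / ε := by ring
        _ ≤ d / ε := by gcongr)
  choose F hFd hFs hFm hFl using key
  refine ⟨fun i => ⋃ j, F j i, ?_, ?_, ?_⟩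
  · intro i V hV V' hV' hne
    obtain ⟨j, hV⟩ := Set.mem_iUnion.1 hV
    obtain ⟨j', hV'⟩ := Set.mem_iUnion.1 hV'
    rcases eq_or_ne j j' with rfl | hj
    · exact hFd j i hV hV' hne
    · rw [Set.disjoint_left]
      intro x hx hx'
      have e1 := hFs j i V hV x hx
      have e2 := hFs j' i V' hV' x hx'
      have l1 : (j : ℝ) < j' + 1 := lt_of_mul_lt_mul_right (by linarith) hH.le
      have l2 : (j' : ℝ) < j + 1 := lt_of_mul_lt_mul_right (by linarith) hH.le
      norm_cast at l1 l2
      omega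
  · intro i V hV x hx y hy
    obtain ⟨j, hV⟩ := Set.mem_iUnion.1 hV
    have e := hFm j i V hV x hx y hy
    have es := hFs j i V hV x hx
    refine ⟨e.1, e.2.trans ?_⟩
    rw [mul_assoc, ← Real.exp_add]
    exact mul_le_mul_of_nonneg_left (Real.exp_le_exp.2 (by linarith)) (by positivity)
  · intro x j hx1 hx2
    have eq1 : ε * (d / ε) = d := by field_simp
    obtain ⟨i, V, hV, hVl⟩ := hFl j x (by rw [eq1]; exact hx1) (by rw [eq1]; exact hx2)
    refine ⟨i, V, Set.mem_iUnion.2 ⟨j, hV⟩, fun y hy => hVl y (by rw [eq1]; exact hy.1)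
      (hy.2.trans ?_)⟩
    have eq2 : ε * (β / ε * Real.exp (-(r + j * H))) = β * Real.exp (-(r + j * H)) := by
      field_simp
    rw [eq2]
    exact mul_le_mul_of_nonneg_left (Real.exp_le_exp.2 (by linarith)) hβ.le

/-- Coverings of the part of `Z × [0, ∞)` above height `r`. -/
theorem exists_upper_family {Z : Type*} [MetricSpace Z] {k : ℕ} {ε τ₀ : ℝ} (hε : 0 < ε)
    (hslab : HasSlabFamilies Z k ε τ₀)
    {r H d d' β β' : ℝ} (hd : 0 < d) (hβ : 0 < β) (hd' : d' = d + d / ε)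
    (hH : H = 2 * (d' + d)) (hβ' : β' = β + β / ε * Real.exp H * Real.exp d)
    (h1 : β' / ε * Real.exp (-(r - H / 2)) < τ₀) (h2 : H * β' * Real.exp (-(r - H / 2)) ≤ d) :
    ∃ F : Fin (k + 1) → Set (Set (Z × ℝ≥0)),
      (∀ i, (F i).Pairwise Disjoint) ∧
      (∀ i, ∀ V ∈ F i, ∀ x ∈ V, ∀ y ∈ V, Near (d' / ε) (β' / ε * Real.exp H) x y) ∧
      (∀ x : Z × ℝ≥0, r ≤ x.2 → ∃ i, ∃ V ∈ F i, ∀ y, Near d β x y → y ∈ V) := by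
  have hdd' : d ≤ d' := by
    have : 0 < d / ε := by positivity
    linarith
  have hHpos : 0 < H := by linarith
  have hββ' : β ≤ β' := by
    have : 0 < β / ε * Real.exp H * Real.exp d := by positivity
    linarith
  have hexp : Real.exp (-r) ≤ Real.exp (-(r - H / 2)) := Real.exp_le_exp.2 (by linarith)
  have hβ'0 : 0 < β' := by linarith
  obtain ⟨F, hFd, hFm, hFl⟩ := exists_layered_family hε hslab (r := r) hHpos hd hβ
    (lt_of_le_of_lt (by gcongr) h1)
    (le_trans (by gcongr) h2)
  obtain ⟨G, hGd, hGm, hGl⟩ := exists_layered_family hε hslab (r := r - H / 2) (d := d') hHpos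
    (by linarith) hβ'0 h1 (h2.trans hdd')
  obtain ⟨W, hWd, hWsub, hFW, hGW⟩ := exists_saturated_union F G hFd hGd _ hFm
  refine ⟨W, hWd, ?_, ?_⟩
  · intro i w hw x hx y hy
    rcases hWsub i w hw with h | ⟨V, hV, hwV⟩
    · exact (hFm i w h x hx y hy).mono (by gcongr) (by gcongr)
    · exact hGm i V hV x (hwV hx) y (hwV hy)
  · intro x hx
    have coarse : ∀ j : ℕ, r - H / 2 + j * H + d' ≤ x.2 →
        x.2 + d' < r - H / 2 + (j + 1) * H →
        ∃ i, ∃ V ∈ W i, ∀ y, Near d β x y → y ∈ V := by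
      intro j hj1 hj2
      obtain ⟨i, V, hV, hVl⟩ := hGl x j hj1 hj2
      obtain ⟨w, hw, hVw⟩ := hGW i V hV
      refine ⟨i, w, hw, fun y hy => hVw y ?_ fun y' hy' => ?_⟩
      · exact hVl y (hy.mono hdd' hββ')
      · exact hVl y' ((hy.trans hy' (by positivity)).mono hd'.ge hβ'.ge)
    have hj0 : 0 ≤ ((x.2 : ℝ) - r) / H := div_nonneg (by linarith) hHpos.le
    have hj1 := Nat.floor_le hj0
    have hj2 := Nat.lt_floor_add_one (((x.2 : ℝ) - r) / H)
    generalize ⌊((x.2 : ℝ) - r) / H⌋₊ = j at hj1 hj2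
    rw [le_div_iff₀ hHpos] at hj1
    rw [div_lt_iff₀ hHpos] at hj2
    by_cases c1 : (x.2 : ℝ) < r + j * H + d
    · exact coarse j (by linarith) (by linarith)
    · by_cases c2 : (x.2 : ℝ) + d < r + (j + 1) * H
      · obtain ⟨i, V, hV, hVl⟩ := hFl x j (by linarith) c2
        obtain ⟨w, hw, hVw⟩ := hFW i V hV
        exact ⟨i, w, hw, fun y hy => hVw (hVl y hy)⟩
      · exact coarse (j + 1) (by push_cast; linarith) (by push_cast; linarith)

/-- Extension of a covering of the part above height `r` to all of `Z × [0, ∞)`. -/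
theorem exists_total_family {Z : Type*} [MetricSpace Z] {k : ℕ} {r d q b S D : ℝ}
    (hq : 0 ≤ q) (hqS : q ≤ S) (hS : S = r + d + q)
    (hD : ∀ z z' : Z, dist z z' ≤ D)
    (F : Fin (k + 1) → Set (Set (Z × ℝ≥0))) (hFd : ∀ i, (F i).Pairwise Disjoint)
    (hFm : ∀ i, ∀ V ∈ F i, ∀ x ∈ V, ∀ y ∈ V, Near q b x y)
    (N : Z × ℝ≥0 → Z × ℝ≥0 → Prop) (hN : ∀ x y, N x y → |(x.2 : ℝ) - y.2| ≤ d)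
    (hFl : ∀ x : Z × ℝ≥0, r ≤ x.2 → ∃ i, ∃ V ∈ F i, ∀ y, N x y → y ∈ V) :
    ∃ W : Fin (k + 1) → Set (Set (Z × ℝ≥0)),
      (∀ i, (W i).Pairwise Disjoint) ∧
      (∀ i, ∀ V ∈ W i, ∀ x ∈ V, ∀ y ∈ V, Near S (max b (D * Real.exp S)) x y) ∧
      (∀ x, ∃ i, ∃ V ∈ W i, ∀ y, N x y → y ∈ V) := by
  let B : Set (Z × ℝ≥0) := {x | (x.2 : ℝ) ≤ S}
  have hBd : ∀ i : Fin (k + 1), Set.Pairwise {V : Set (Z × ℝ≥0) | i = 0 ∧ V = B} Disjoint := by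
    rintro i V ⟨-, rfl⟩ V' ⟨-, rfl⟩ hne
    exact absurd rfl hne
  obtain ⟨W, hWd, hWsub, hFW, hGW⟩ := exists_saturated_union F (fun i => {V | i = 0 ∧ V = B}) hFd
    hBd _ hFm
  refine ⟨W, hWd, ?_, ?_⟩
  · intro i w hw x hx y hy
    rcases hWsub i w hw with h | ⟨V, ⟨-, rfl⟩, hwV⟩
    · exact (hFm i w h x hx y hy).mono hqS (le_max_left _ _)
    · have hx : (x.2 : ℝ) ≤ S := hwV hx
      have hy : (y.2 : ℝ) ≤ S := hwV hy
      have hx0 := x.2.coe_nonneg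
      have hy0 := y.2.coe_nonneg
      have hD0 : 0 ≤ D := dist_nonneg.trans (hD x.1 y.1)
      refine Near.mono (b := D * Real.exp S) ⟨abs_le.2 ⟨by linarith, by linarith⟩, ?_⟩ le_rfl
        (le_max_right _ _)
      rw [mul_assoc, ← Real.exp_add]
      exact (hD _ _).trans (le_mul_of_one_le_right hD0 (Real.one_le_exp (by linarith)))
  · intro x
    by_cases hx : r ≤ x.2
    · obtain ⟨i, V, hV, hVl⟩ := hFl x hx
      obtain ⟨w, hw, hVw⟩ := hFW i V hV
      exact ⟨i, w, hw, fun y hy => hVw (hVl y hy)⟩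
    · obtain ⟨w, hw, hBw⟩ := hGW 0 B ⟨rfl, rfl⟩
      refine ⟨0, w, hw, fun y hy => ?_⟩
      have h1 := abs_le.1 (hN x y hy)
      refine hBw y (show (y.2 : ℝ) ≤ S by linarith) fun y' hy' => ?_
      have h2 := abs_le.1 hy'.1
      exact show (y'.2 : ℝ) ≤ S by linarith

/-- A coloured family on `Y` that contains the preimages of all `L`-balls of `X` descends along a
surjection `Y → X`. -/
theorem exists_isLMNCover_of_surjective {Y X : Type*} [PseudoMetricSpace X] {m : ℕ} {h : Y → X}
    (hh : Function.Surjective h) {L M : ℝ} (hL : 0 < L) (F : Fin m → Set (Set Y))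
    (hFd : ∀ i, (F i).Pairwise Disjoint)
    (hFm : ∀ i, ∀ V ∈ F i, ∀ x ∈ V, ∀ y ∈ V, dist (h x) (h y) ≤ M)
    (hFl : ∀ x, ∃ i, ∃ V ∈ F i, ∀ y, dist (h x) (h y) ≤ L → y ∈ V) :
    ∃ U : Set (Set X), IsLMNCover U Set.univ L M m := by
  let f : Set Y → Set X := fun V => interior {c | ∀ y, h y = c → y ∈ V}
  have hball : ∀ c, ∃ i, ∃ V ∈ F i, ∀ c', dist c c' ≤ L → c' ∈ {c | ∀ y, h y = c → y ∈ V} := by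
    intro c
    obtain ⟨x, rfl⟩ := hh c
    obtain ⟨i, V, hV, hVl⟩ := hFl x
    refine ⟨i, V, hV, ?_⟩
    rintro c' hc' y rfl
    exact hVl y hc'
  have hfpre : ∀ V, ∀ c ∈ f V, ∀ y, h y = c → y ∈ V := fun V c hc => interior_subset hc
  refine ⟨⋃ i, f '' F i, ?_, ?_, ⟨fun i => f '' F i, rfl, ?_⟩, ?_, ?_⟩
  · intro V hV
    obtain ⟨i, V, hV, rfl⟩ := Set.mem_iUnion.1 hV
    exact isOpen_interior
  · intro c _
    obtain ⟨i, V, hV, hVl⟩ := hball c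
    refine ⟨f V, Set.mem_iUnion.2 ⟨i, V, hV, rfl⟩, ?_⟩
    refine mem_interior.2 ⟨Metric.ball c L, fun c' hc' => hVl c' ?_, Metric.isOpen_ball,
      Metric.mem_ball_self hL⟩
    rw [dist_comm]
    exact (Metric.mem_ball.1 hc').le
  · rintro i _ ⟨V, hV, rfl⟩ _ ⟨V', hV', rfl⟩ hne
    have hd := hFd i hV hV' (fun h => hne (by rw [h]))
    rw [Set.disjoint_left] at hd ⊢
    intro c hc hc'
    obtain ⟨y, hy⟩ := hh c
    exact hd (hfpre V c hc y hy) (hfpre V' c hc' y hy)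
  · refine iSup₂_le fun V hV => ?_
    obtain ⟨i, V, hVF, rfl⟩ := Set.mem_iUnion.1 hV
    refine Metric.ediam_le fun c hc c' hc' => ?_
    obtain ⟨y, rfl⟩ := hh c
    obtain ⟨y', rfl⟩ := hh c'
    rw [edist_dist]
    exact ENNReal.ofReal_le_ofReal
      (hFm i V hVF y (hfpre V _ hc y rfl) y' (hfpre V _ hc' y' rfl))
  · refine le_iInf₂ fun c _ => ?_
    obtain ⟨i, V, hV, hVl⟩ := hball c
    refine le_iSup₂_of_le (f V) (Set.mem_iUnion.2 ⟨i, V, hV, rfl⟩) ?_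
    change _ ≤ Metric.infEDist c (f V)ᶜ
    rw [← closure_compl, Metric.infEDist_closure, Metric.le_infEDist]
    intro c' hc'
    rw [edist_dist]
    refine ENNReal.ofReal_le_ofReal (le_of_not_ge fun hlt => hc' (hVl c' hlt))

theorem cosh_sub_add_eq (s t θ : ℝ) :
    Real.cosh s * Real.cosh t - Real.sinh s * Real.sinh t * Real.cos θ =
      Real.cosh (s - t) + Real.sinh s * Real.sinh t * (1 - Real.cos θ) := by
  rw [Real.cosh_sub]
  ring

theorem cosh_sub_le_coneArg {s t : ℝ} (hs : 0 ≤ s) (ht : 0 ≤ t) (θ : ℝ) :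
    Real.cosh (s - t) ≤ Real.cosh s * Real.cosh t - Real.sinh s * Real.sinh t * Real.cos θ := by
  rw [cosh_sub_add_eq]
  have h1 := Real.sinh_nonneg_iff.2 hs
  have h2 := Real.sinh_nonneg_iff.2 ht
  have h3 := Real.cos_le_one θ
  have := mul_nonneg (mul_nonneg h1 h2) (sub_nonneg.2 h3)
  linarith

theorem exp_div_four_le_sinh {t : ℝ} (ht : 1 ≤ t) : Real.exp t / 4 ≤ Real.sinh t := by
  have h1 : Real.exp (-t) ≤ 1 := Real.exp_le_one_iff.2 (by linarith)
  have h2 := Real.add_one_le_exp t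
  rw [Real.sinh_eq]
  linarith

theorem cosh_le_exp_abs (t : ℝ) : Real.cosh t ≤ Real.exp |t| := by
  have h1 := Real.exp_le_exp.2 (le_abs_self t)
  have h2 := Real.exp_le_exp.2 (neg_le_abs t)
  rw [Real.cosh_eq]
  linarith

section ConeMetric

variable {Z : Type*} [MetricSpace Z] (x y : Z × ℝ≥0)

theorem coneDist_nonneg : 0 ≤ coneDist x y :=
  Real.arcosh_nonneg ((Real.one_le_cosh _).trans (cosh_sub_le_coneArg x.2.2 y.2.2 _))

theorem cosh_coneDist : Real.cosh (coneDist x y) = Real.cosh x.2 * Real.cosh y.2 -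
    Real.sinh x.2 * Real.sinh y.2 *
      Real.cos (Real.pi / Metric.diam (Set.univ : Set Z) * dist x.1 y.1) :=
  Real.cosh_arcosh ((Real.one_le_cosh _).trans (cosh_sub_le_coneArg x.2.2 y.2.2 _))

theorem abs_sub_le_coneDist : |(x.2 : ℝ) - y.2| ≤ coneDist x y := by
  rw [← abs_of_nonneg (coneDist_nonneg x y), ← Real.cosh_le_cosh, cosh_coneDist]
  exact cosh_sub_le_coneArg x.2.2 y.2.2 _

variable {x y}

theorem near_of_coneDist_le (hb : Bornology.IsBounded (Set.univ : Set Z))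
    (hd : 0 < Metric.diam (Set.univ : Set Z)) {d : ℝ} (hx : 1 ≤ (x.2 : ℝ)) (hy : 1 ≤ (y.2 : ℝ))
    (h : coneDist x y ≤ d) :
    Near d (3 * Metric.diam (Set.univ : Set Z) * Real.exp d) x y := by
  have hr := (abs_sub_le_coneDist x y).trans h
  refine ⟨hr, ?_⟩
  have hdist : dist x.1 y.1 ≤ Metric.diam (Set.univ : Set Z) :=
    Metric.dist_le_diam_of_mem hb (Set.mem_univ _) (Set.mem_univ _)
  have hcosh := cosh_coneDist x y
  generalize Metric.diam (Set.univ : Set Z) = D at *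
  have hρ : 0 ≤ dist x.1 y.1 := dist_nonneg
  generalize dist x.1 y.1 = ρ at *
  have hcos : Real.cos (Real.pi / D * ρ) ≤ 1 - 2 * (ρ / D) ^ 2 := by
    refine (Real.cos_le_one_sub_mul_cos_sq ?_).trans_eq ?_
    · rw [abs_of_nonneg (by positivity), div_mul_eq_mul_div, div_le_iff₀ hd]
      exact mul_le_mul_of_nonneg_left hdist Real.pi_pos.le
    · field_simp
  have h0 : Real.cosh (coneDist x y) ≤ Real.exp d := by
    refine (cosh_le_exp_abs _).trans (Real.exp_le_exp.2 ?_)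
    rwa [abs_of_nonneg (coneDist_nonneg x y)]
  rw [hcosh, cosh_sub_add_eq] at h0
  have hs : Real.exp x.2 / 4 * (Real.exp y.2 / 4) * (2 * (ρ / D) ^ 2) ≤
      Real.sinh x.2 * Real.sinh y.2 * (1 - Real.cos (Real.pi / D * ρ)) := by
    have := exp_div_four_le_sinh hx
    have := exp_div_four_le_sinh hy
    have : 0 < Real.sinh x.2 := Real.sinh_pos_iff.2 (by linarith)
    gcongr
    linarith
  have hc := Real.cosh_pos ((x.2 : ℝ) - y.2)
  have hy' : Real.exp x.2 * Real.exp (-d) ≤ Real.exp y.2 := by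
    rw [← Real.exp_add]
    exact Real.exp_le_exp.2 (by linarith [(abs_le.1 hr).2])
  have h3 : (Real.exp x.2 * (ρ / D)) ^ 2 ≤ (3 * Real.exp d) ^ 2 := by
    have e1 : Real.exp x.2 / 4 * (Real.exp x.2 * Real.exp (-d) / 4) * (2 * (ρ / D) ^ 2) ≤
        Real.exp d := le_trans (by gcongr) (hs.trans (by linarith))
    have e2 : Real.exp (-d) * Real.exp d = 1 := by rw [← Real.exp_add]; simp
    have e3 := mul_le_mul_of_nonneg_right e1 (Real.exp_pos d).le
    have e4 : Real.exp x.2 / 4 * (Real.exp x.2 * Real.exp (-d) / 4) * (2 * (ρ / D) ^ 2) *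
        Real.exp d = (Real.exp x.2 * (ρ / D)) ^ 2 * (Real.exp (-d) * Real.exp d) / 8 := by ring
    rw [e4, e2] at e3
    nlinarith [sq_nonneg (Real.exp d)]
  have h5 := (abs_le_of_sq_le_sq' h3 (by positivity)).2
  rw [← mul_div_assoc, div_le_iff₀ hd] at h5
  rw [Real.exp_neg, ← div_eq_mul_inv, le_div_iff₀ (Real.exp_pos _)]
  linarith

theorem coneDist_le_of_near {a b c : ℝ} (h : Near a b x y)
    (hc : 2 * (1 + (Real.pi / Metric.diam (Set.univ : Set Z)) ^ 2 * b ^ 2) ≤ Real.exp c) :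
    coneDist x y ≤ a + c := by
  obtain ⟨hr, hz⟩ := h
  have hcosh := cosh_coneDist x y
  generalize Real.pi / Metric.diam (Set.univ : Set Z) = μ at *
  have hρ : 0 ≤ dist x.1 y.1 := dist_nonneg
  generalize dist x.1 y.1 = ρ at *
  have hsinh : ∀ t : ℝ≥0, Real.sinh t ≤ Real.exp t := fun t => by
    rw [Real.sinh_eq]
    linarith [Real.exp_pos (t : ℝ), Real.exp_pos (-t : ℝ)]
  have hsinh0 : ∀ t : ℝ≥0, 0 ≤ Real.sinh t := fun t => Real.sinh_nonneg_iff.2 t.coe_nonneg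
  have hcos : 1 - Real.cos (μ * ρ) ≤ μ ^ 2 * ρ ^ 2 := by
    have := Real.one_sub_sq_div_two_le_cos (x := μ * ρ)
    rw [mul_pow] at this
    nlinarith [mul_nonneg (sq_nonneg μ) (sq_nonneg ρ)]
  have hy' : Real.exp y.2 ≤ Real.exp a * Real.exp x.2 := by
    rw [← Real.exp_add]
    exact Real.exp_le_exp.2 (by linarith [(abs_le.1 hr).1])
  have h1 : Real.sinh x.2 * Real.sinh y.2 * (1 - Real.cos (μ * ρ)) ≤
      Real.exp x.2 * (Real.exp a * Real.exp x.2) * (μ ^ 2 * (b * Real.exp (-x.2)) ^ 2) := by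
    have := hsinh x.2
    have := (hsinh y.2).trans hy'
    have := hsinh0 x.2
    have := hsinh0 y.2
    have h6 := Real.cos_le_one (μ * ρ)
    refine mul_le_mul (by gcongr) (hcos.trans (by gcongr)) (by linarith) (by positivity)
  have h2 : Real.exp x.2 * (Real.exp a * Real.exp x.2) * (μ ^ 2 * (b * Real.exp (-x.2)) ^ 2) =
      Real.exp a * (μ ^ 2 * b ^ 2) := by
    have e : Real.exp x.2 * Real.exp (-x.2) = 1 := by rw [← Real.exp_add]; simp
    calc _ = Real.exp a * (μ ^ 2 * b ^ 2) * (Real.exp x.2 * Real.exp (-x.2)) ^ 2 := by ring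
      _ = _ := by rw [e]; ring
  have h3 : Real.cosh (coneDist x y) ≤ Real.exp a * (1 + μ ^ 2 * b ^ 2) := by
    rw [hcosh, cosh_sub_add_eq]
    have := (cosh_le_exp_abs ((x.2 : ℝ) - y.2)).trans (Real.exp_le_exp.2 hr)
    linarith
  rw [Real.cosh_eq] at h3
  rw [← Real.exp_le_exp, Real.exp_add]
  have h4 := mul_le_mul_of_nonneg_left hc (Real.exp_pos a).le
  linarith [Real.exp_pos (-coneDist x y)]

end ConeMetric

theorem lasdimLE_of_elldimLE {Z : Type*} [MetricSpace Z]
    (hb : Bornology.IsBounded (Set.univ : Set Z))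
    (hd : 0 < Metric.diam (Set.univ : Set Z))
    {C : Type*} [MetricSpace C] {h : Z × ℝ≥0 → C} (hc : IsHypCone Z C h) {k : ℕ}
    (hk : ElldimLE (Z × Set.Icc (0 : ℝ) 1) k) : LasdimLE C k := by
  obtain ⟨ε, hε, τ₀, hτ₀, hslab⟩ := exists_hasSlabFamilies hk
  set D := Metric.diam (Set.univ : Set Z) with hD
  set μ := Real.pi / D with hμ
  set κ := 1 / ε with hκ
  have hκ0 : 0 < κ := by positivity
  set M := 4 + 3 * D + 2 * κ + 2 / τ₀ + 2 * μ ^ 2 with hM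
  have hM0 : 0 < M := by positivity
  refine ⟨3 * (15 + 4 * κ + κ ^ 2) + 29 + 8 * κ, by nlinarith, max 1 (Real.log M), fun d hdd => ?_⟩
  have hd1 : 1 ≤ d := (le_max_left _ _).trans hdd
  have hd0 : 0 < d := by linarith
  have hMd : M ≤ Real.exp d := (Real.log_le_iff_le_exp hM0).1 ((le_max_right _ _).trans hdd)
  have hτ0 : 0 < 2 / τ₀ := by positivity
  have hμ2 := sq_nonneg μ
  have hεd : 1 / ε ≤ Real.exp d := by linarith
  set H := (4 + 2 * κ) * d with hH
  set d' := d + d / ε with hd'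
  have hdε : d / ε = κ * d := by rw [hκ]; ring
  have hH0 : 0 < H := by positivity
  set β := 3 * D * Real.exp d with hβ
  have hβ0 : 0 < β := by positivity
  set β' := β + β / ε * Real.exp H * Real.exp d with hβ'
  set r := 8 * d + 3 / 2 * H with hr
  set S := r + d + d' / ε with hS
  have hq0 : 0 ≤ d' / ε := by positivity
  have hβd : β ≤ Real.exp (2 * d) := by
    rw [two_mul, Real.exp_add]
    exact mul_le_mul_of_nonneg_right (by linarith) (Real.exp_pos d).le
  have div_le : ∀ {u s : ℝ}, 0 ≤ u → u ≤ Real.exp s → u / ε ≤ Real.exp (s + d) := by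
    intro u s hu hus
    rw [div_eq_mul_one_div, Real.exp_add]
    exact mul_le_mul hus hεd (by positivity) (Real.exp_pos s).le
  have hβ'd : β' ≤ Real.exp (5 * d + H) := by
    have e1 : β / ε * Real.exp H * Real.exp d ≤ Real.exp (4 * d + H) := by
      calc _ ≤ Real.exp (2 * d + d) * Real.exp H * Real.exp d := by
            gcongr
            exact div_le hβ0.le hβd
        _ = _ := by
            rw [← Real.exp_add, ← Real.exp_add]
            congr 1
            ring
    have e2 : Real.exp (2 * d) ≤ Real.exp (4 * d + H) := Real.exp_le_exp.2 (by linarith)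
    have e3 : Real.exp (5 * d + H) = Real.exp d * Real.exp (4 * d + H) := by
      rw [← Real.exp_add]
      congr 1
      ring
    nlinarith [Real.exp_pos (4 * d + H)]
  have hβ'0 : 0 < β' := by positivity
  have hβ'ε := div_le hβ'0.le hβ'd
  have h1 : β' / ε * Real.exp (-(r - H / 2)) < τ₀ := by
    calc β' / ε * Real.exp (-(r - H / 2))
        ≤ Real.exp (5 * d + H + d) * Real.exp (-(r - H / 2)) := by gcongr
      _ = Real.exp (-(2 * d)) := by
          rw [← Real.exp_add]
          congr 1
          rw [hr]
          ring
      _ ≤ Real.exp (-d) := Real.exp_le_exp.2 (by linarith)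
      _ < τ₀ := by
          rw [Real.exp_neg, inv_lt_comm₀ (Real.exp_pos d) hτ₀]
          have : 2 / τ₀ = 2 * τ₀⁻¹ := by ring
          linarith
  have h2 : H * β' * Real.exp (-(r - H / 2)) ≤ d := by
    have hHd : H ≤ Real.exp d * d := mul_le_mul_of_nonneg_right (by linarith) hd0.le
    calc H * β' * Real.exp (-(r - H / 2))
        ≤ Real.exp d * d * Real.exp (5 * d + H) * Real.exp (-(r - H / 2)) := by gcongr
      _ = d * Real.exp (-(2 * d)) := by
          rw [mul_comm (Real.exp d), mul_assoc, mul_assoc, ← Real.exp_add, ← Real.exp_add]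
          congr 2
          rw [hr]
          ring
      _ ≤ d := mul_le_of_le_one_right hd0.le (Real.exp_le_one_iff.2 (by linarith))
  have hHeq : H = 2 * (d' + d) := by
    rw [hH, hd', hdε]
    ring
  obtain ⟨F, hFd, hFm, hFl⟩ := exists_upper_family hε hslab hd0 hβ0 hd' hHeq hβ' h1 h2
  obtain ⟨W, hWd, hWm, hWl⟩ := exists_total_family (D := D) hq0 (by linarith) hS
    (fun z z' => Metric.dist_le_diam_of_mem hb (Set.mem_univ _) (Set.mem_univ _)) F hFd hFm
    (fun x y => dist (h x) (h y) ≤ d)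
    (fun x y hxy => (abs_sub_le_coneDist x y).trans (hc.2 x y ▸ hxy)) (by
      intro x hx
      obtain ⟨i, V, hV, hVl⟩ := hFl x hx
      refine ⟨i, V, hV, fun y hxy => hVl y ?_⟩
      rw [hc.2 x y] at hxy
      have := abs_le.1 ((abs_sub_le_coneDist x y).trans hxy)
      exact near_of_coneDist_le hb hd (by linarith) (by linarith) hxy)
  refine exists_isLMNCover_of_surjective hc.1 hd0 W hWd (fun i V hV x hx y hy => ?_) hWl
  set s := S + 6 * d + 2 * H with hs
  have hbs : max (β' / ε * Real.exp H) (D * Real.exp S) ≤ Real.exp s := by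
    refine max_le ?_ ?_
    · calc β' / ε * Real.exp H ≤ Real.exp (5 * d + H + d) * Real.exp H := by gcongr
        _ ≤ Real.exp s := by
          rw [← Real.exp_add]
          exact Real.exp_le_exp.2 (by linarith)
    · calc D * Real.exp S ≤ Real.exp d * Real.exp S := by
            gcongr
            linarith
        _ ≤ Real.exp s := by
          rw [← Real.exp_add]
          exact Real.exp_le_exp.2 (by linarith)
  have hfin := coneDist_le_of_near (c := d + 2 * s) ((hWm i V hV x hx y hy).mono le_rfl hbs) (by
    have e1 : Real.exp (d + 2 * s) = Real.exp d * Real.exp s ^ 2 := by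
      rw [Real.exp_add, two_mul, Real.exp_add]
      ring
    have e2 : 1 ≤ Real.exp s ^ 2 := one_le_pow₀ (Real.one_le_exp (by linarith))
    have e3 : (2 + 2 * μ ^ 2) * Real.exp s ^ 2 ≤ Real.exp d * Real.exp s ^ 2 := by
      gcongr
      linarith
    rw [e1]
    linarith)
  rw [hc.2]
  refine hfin.trans_eq ?_
  have hq : d' / ε = (1 + κ) * κ * d := by
    rw [hd', hκ]
    ring
  rw [hs, hS, hq, hr, hH]
  ring

/-- **Proposition (lasdim).** For a bounded metric space `Z` of positive diameter,
`ℓ-asdim (Co Z) ≤ ℓ-dim (Z × [0,1])`. -/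
theorem lasdim_cone_le_elldim
    {Z : Type*} [MetricSpace Z]
    (hb : Bornology.IsBounded (Set.univ : Set Z))
    (hd : 0 < Metric.diam (Set.univ : Set Z))
    (C : Type*) [MetricSpace C] (h : Z × ℝ≥0 → C) (hc : IsHypCone Z C h) :
    lasdim C ≤ elldim (Z × Set.Icc (0:ℝ) 1) := by
  refine le_sInf ?_
  rintro _ ⟨k, rfl, hk⟩
  exact sInf_le ⟨k, rfl, lasdimLE_of_elldimLE hb hd hc hk⟩
end
end

section
/- Let Z₁, …, Zₙ be bounded metric spaces of positive diameter. Then ℓ-dim(Z₁ × ⋯ × Zₙ × [0,1]ⁿ) ≤ asdim(Co(Z₁) × ⋯ × Co(Zₙ)), where Co denotes the hyperbolic cone and all products carry the l∞ metric. -/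
open Metric Set Filter ENNReal NNReal

noncomputable section

open PaperDefs

namespace PaperDefs

/-! ### Mesh and Lebesgue number in terms of the distance -/

lemma dist_le_of_meshF_lt_top {X : Type*} [PseudoMetricSpace X] {U : Set (Set X)}
    (hU : meshF U < ⊤) :
    ∃ D : ℝ, 0 ≤ D ∧ ∀ V ∈ U, ∀ x ∈ V, ∀ y ∈ V, dist x y ≤ D := by
  refine ⟨(meshF U).toReal, ENNReal.toReal_nonneg, fun V hV x hx y hy => ?_⟩
  rw [dist_edist]
  refine ENNReal.toReal_mono hU.ne ?_
  exact (Metric.edist_le_ediam_of_mem hx hy).trans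
    (le_iSup₂ (f := fun V (_ : V ∈ U) => Metric.ediam V) V hV)

lemma meshF_le_ofReal {X : Type*} [PseudoMetricSpace X] {U : Set (Set X)} {τ : ℝ}
    (hU : ∀ V ∈ U, ∀ x ∈ V, ∀ y ∈ V, dist x y ≤ τ) : meshF U ≤ ENNReal.ofReal τ := by
  refine iSup₂_le fun V hV => Metric.ediam_le fun x hx y hy => ?_
  rw [edist_dist]
  exact ENNReal.ofReal_le_ofReal (hU V hV x hx y hy)

lemma exists_ball_subset_of_lt_lebesgueF {X : Type*} [PseudoMetricSpace X] {U : Set (Set X)}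
    {d : ℝ} (hU : ENNReal.ofReal d < lebesgueF U Set.univ) (x : X) :
    ∃ V ∈ U, ball x d ⊆ V := by
  have hx : ENNReal.ofReal d < ⨆ V ∈ U, Metric.infEDist x Vᶜ :=
    hU.trans_le (iInf₂_le (f := fun z (_ : z ∈ Set.univ) => ⨆ V ∈ U, Metric.infEDist z Vᶜ) x
      (Set.mem_univ x))
  simp only [lt_iSup_iff] at hx
  obtain ⟨V, hV, hxV⟩ := hx
  refine ⟨V, hV, fun y hy => ?_⟩
  by_contra hyV
  have h1 : ENNReal.ofReal d < edist x y := hxV.trans_le (Metric.infEDist_le_edist_of_mem hyV)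
  rw [edist_dist, dist_comm] at h1
  exact absurd (ENNReal.ofReal_le_ofReal (mem_ball.1 hy).le) (not_le.2 h1)

lemma ofReal_le_lebesgueF {X : Type*} [PseudoMetricSpace X] {U : Set (Set X)} {d : ℝ}
    (hU : ∀ x, ∃ V ∈ U, ball x d ⊆ V) : ENNReal.ofReal d ≤ lebesgueF U Set.univ := by
  refine le_iInf₂ fun x _ => ?_
  obtain ⟨V, hV, hxV⟩ := hU x
  refine le_trans ?_ (le_iSup₂ (f := fun V (_ : V ∈ U) => Metric.infEDist x Vᶜ) V hV)
  refine Metric.le_infEDist.2 fun y hy => ?_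
  rw [edist_dist]
  refine ENNReal.ofReal_le_ofReal ?_
  by_contra hlt
  exact hy (hxV (by rw [mem_ball, dist_comm]; exact not_le.1 hlt))

/-! ### From bounded multiplicity to colorings -/

/-- A `1`-Lipschitz nonnegative function measuring the depth of a point inside `V`. -/
lemma exists_depth {X : Type*} [PseudoMetricSpace X] (V : Set X) (d : ℝ) :
    ∃ φ : X → ℝ, (∀ x y, φ x ≤ φ y + dist x y) ∧ (∀ x, 0 < φ x → x ∈ V) ∧
      ∀ x, ball x d ⊆ V → d ≤ φ x := by
  by_cases hV : V = Set.univ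
  · refine ⟨fun _ => d, fun x y => by simp, fun x _ => hV ▸ Set.mem_univ x, fun x _ => le_rfl⟩
  · have hne : (Vᶜ).Nonempty := Set.nonempty_compl.2 hV
    refine ⟨fun x => Metric.infDist x Vᶜ, fun x y => Metric.infDist_le_infDist_add_dist,
      fun x hx => ?_, fun x hx => ?_⟩
    · by_contra hxV
      exact hx.ne' (Metric.infDist_zero_of_mem hxV)
    · refine (Metric.le_infDist hne).2 fun y hy => ?_
      by_contra hlt
      exact hy (hx (by rw [mem_ball, dist_comm]; exact not_le.1 hlt))

/-- Among at most `m + 1` reals, one of the `m + 2` intervals `(jε, (j+1)ε)` is free. -/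
lemma exists_gap {α : Type*} (P : Finset α) {m : ℕ} (hP : P.card ≤ m + 1) (φ : α → ℝ) {ε : ℝ}
    (hε : 0 < ε) :
    ∃ j : Fin (m + 2), ∀ V ∈ P, φ V ≤ (j : ℕ) * ε ∨ ((j : ℕ) + 1) * ε ≤ φ V := by
  by_contra! hcon
  choose g hgP hg₁ hg₂ using hcon
  have hinj : Function.Injective g := by
    have key : ∀ i j : Fin (m + 2), g i = g j → (i : ℕ) ≤ j := by
      intro i j hij
      have h1 : ((i : ℕ) : ℝ) * ε < ((j : ℕ) + 1) * ε := (hg₁ i).trans (hij ▸ hg₂ j)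
      have h2 : ((i : ℕ) : ℝ) < ((j : ℕ) + 1 : ℕ) := by
        push_cast
        exact lt_of_mul_lt_mul_right h1 hε.le
      exact Nat.lt_succ_iff.1 (Nat.cast_lt.1 h2)
    intro i j hij
    exact Fin.ext (le_antisymm (key i j hij) (key j i hij.symm))
  have hcard := Finset.card_le_card_of_injOn (s := Finset.univ) (t := P) g
    (fun i _ => hgP i) hinj.injOn
  simp only [Finset.card_univ, Fintype.card_fin] at hcard
  omega

/-- The set where all the functions indexed by `S` dominate all the others in `U`. -/
def dominance {X : Type*} (U : Set (Set X)) (φ : Set X → X → ℝ) (S : Finset (Set X)) : Set X :=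
  {x | ∃ a : ℝ, 0 ≤ a ∧ ∃ e : ℝ, 0 < e ∧ (∀ V ∈ S, a + e ≤ φ V x) ∧
    ∀ V ∈ U, V ∉ S → φ V x ≤ a}

lemma ball_subset_dominance {X : Type*} [PseudoMetricSpace X] {U : Set (Set X)}
    {φ : Set X → X → ℝ} (hφ : ∀ V x y, φ V x ≤ φ V y + dist x y) {S : Finset (Set X)} {x : X}
    {a e : ℝ} (ha : 0 ≤ a) (he : 0 < e) (hS : ∀ V ∈ S, a + e ≤ φ V x)
    (hU : ∀ V ∈ U, V ∉ S → φ V x ≤ a) : ball x (e / 3) ⊆ dominance U φ S := by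
  intro y hy
  rw [mem_ball] at hy
  refine ⟨a + e / 3, by positivity, e / 3, by positivity, fun V hV => ?_, fun V hV hVS => ?_⟩
  · have h1 := hφ V x y
    rw [dist_comm] at h1
    linarith [hS V hV]
  · linarith [hU V hV hVS, hφ V y x]

lemma isOpen_dominance {X : Type*} [PseudoMetricSpace X] {U : Set (Set X)}
    {φ : Set X → X → ℝ} (hφ : ∀ V x y, φ V x ≤ φ V y + dist x y) (S : Finset (Set X)) :
    IsOpen (dominance U φ S) := by
  refine Metric.isOpen_iff.2 ?_
  rintro x ⟨a, ha, e, he, hS, hU⟩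
  exact ⟨e / 3, by positivity, ball_subset_dominance hφ ha he hS hU⟩

lemma disjoint_dominance {X : Type*} {U : Set (Set X)} {φ : Set X → X → ℝ}
    {S S' : Finset (Set X)} (hS : (S : Set (Set X)) ⊆ U) (hS' : (S' : Set (Set X)) ⊆ U)
    (hcard : S.card = S'.card) (hne : S ≠ S') :
    Disjoint (dominance U φ S) (dominance U φ S') := by
  obtain ⟨V, hV, hVS'⟩ : ∃ V ∈ S, V ∉ S' := by
    by_contra! hsub
    exact hne (Finset.eq_of_subset_of_card_le hsub hcard.ge)
  obtain ⟨V', hV', hVS⟩ : ∃ V ∈ S', V ∉ S := by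
    by_contra! hsub
    exact hne (Finset.eq_of_subset_of_card_le hsub hcard.le).symm
  refine Set.disjoint_left.2 ?_
  rintro x ⟨a, -, e, he, h1, h2⟩ ⟨a', -, e', he', h1', h2'⟩
  linarith [h1 V hV, h1' V' hV', h2' V (hS hV) hVS', h2 V' (hS' hV') hVS]

/-- An open covering of multiplicity at most `m + 1` with positive Lebesgue number is refined by
an `(m + 1)`-colored open covering with positive Lebesgue number. -/
lemma exists_colored_refinement {X : Type*} [PseudoMetricSpace X] {U : Set (Set X)} {m : ℕ}
    (hmult : MultiplicityLE U (m + 1)) {d : ℝ} (hd : 0 < d)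
    (hleb : ∀ x, ∃ V ∈ U, ball x d ⊆ V) :
    ∃ F : Fin (m + 1) → Set (Set X), (∀ i, ∀ W ∈ F i, IsOpen W) ∧
      (∀ i, (F i).Pairwise Disjoint) ∧ (∀ i, ∀ W ∈ F i, ∃ V ∈ U, W ⊆ V) ∧
      ∃ ε : ℝ, 0 < ε ∧ ∀ x, ∃ i, ∃ W ∈ F i, ball x ε ⊆ W := by
  classical
  choose φ hφ hφmem hφd using fun V : Set X => exists_depth V d
  refine ⟨fun i => {W | ∃ S : Finset (Set X), (S : Set (Set X)) ⊆ U ∧ S.card = i + 1 ∧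
    W = dominance U φ S}, ?_, ?_, ?_, d / (m + 2) / 3, by positivity, fun x => ?_⟩
  · rintro i _ ⟨S, -, -, rfl⟩
    exact isOpen_dominance hφ S
  · rintro i _ ⟨S, hS, hSc, rfl⟩ _ ⟨S', hS', hSc', rfl⟩ hne
    exact disjoint_dominance hS hS' (hSc.trans hSc'.symm) fun hSS => hne (by rw [hSS])
  · rintro i _ ⟨S, hS, hSc, rfl⟩
    obtain ⟨V, hV⟩ : S.Nonempty := Finset.card_pos.1 (by omega)
    refine ⟨V, hS hV, ?_⟩
    rintro x ⟨a, ha, e, he, h1, -⟩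
    exact hφmem V x (by linarith [h1 V hV])
  · have hbound : ∀ s : Finset (Set X), (s : Set (Set X)) ⊆ {V ∈ U | x ∈ V} → s.card ≤ m + 1 :=
      fun s hs => hmult s (fun V hV => (hs hV).1) ⟨x, fun V hV => (hs hV).2⟩
    have hfin : {V ∈ U | x ∈ V}.Finite := by
      by_contra hinf
      obtain ⟨s, hs, hsc⟩ := Set.Infinite.exists_subset_card_eq hinf (m + 2)
      have := hbound s hs
      omega
    set ε : ℝ := d / (m + 2) with hεdef
    have hε : 0 < ε := by positivity
    have hdε : d = (m + 2) * ε := by rw [hεdef]; field_simp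
    have hPc : hfin.toFinset.card ≤ m + 1 := hbound _ (by simp)
    obtain ⟨j, hj⟩ := exists_gap hfin.toFinset hPc (fun V => φ V x) hε
    set S : Finset (Set X) := hfin.toFinset.filter fun V => ((j : ℕ) + 1) * ε ≤ φ V x with hSdef
    have hSsub : S ⊆ hfin.toFinset := Finset.filter_subset _ _
    have hSU : (S : Set (Set X)) ⊆ U := fun V hV =>
      ((Set.Finite.mem_toFinset hfin).1 (hSsub hV)).1
    have hSne : S.Nonempty := by
      obtain ⟨V, hV, hxV⟩ := hleb x
      have hdV : d ≤ φ V x := hφd V x hxV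
      refine ⟨V, Finset.mem_filter.2 ⟨(Set.Finite.mem_toFinset hfin).2
        ⟨hV, hφmem V x (hd.trans_le hdV)⟩, le_trans ?_ hdV⟩⟩
      rw [hdε]
      have hj2 : ((j : ℕ) : ℝ) + 1 ≤ m + 2 := by exact_mod_cast j.isLt
      exact mul_le_mul_of_nonneg_right hj2 hε.le
    have hSc : S.card ≤ m + 1 := (Finset.card_le_card hSsub).trans hPc
    have hSpos := hSne.card_pos
    refine ⟨⟨S.card - 1, by omega⟩, dominance U φ S, ⟨S, hSU, ?_, rfl⟩,
      ball_subset_dominance hφ (a := (j : ℕ) * ε) (by positivity) hε (fun V hV => ?_)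
        fun V hV hVS => ?_⟩
    · simp only
      omega
    · have := (Finset.mem_filter.1 hV).2
      linarith
    · by_cases hxV : x ∈ V
      · have hmem : V ∈ hfin.toFinset := (Set.Finite.mem_toFinset hfin).2 ⟨hV, hxV⟩
        refine (hj V hmem).resolve_right fun hle => hVS ?_
        exact Finset.mem_filter.2 ⟨hmem, hle⟩
      · have h0 : φ V x ≤ 0 := not_lt.1 fun hpos => hxV (hφmem V x hpos)
        exact h0.trans (by positivity)

/-! ### Pulling back colored coverings along folded maps -/

lemma abs_sub_lt_pi_of_cos {w w' : ℝ} {k : ℤ} (hk : |w - 2 * Real.pi * k| ≤ Real.pi)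
    (hcos : -(1 / 2) ≤ Real.cos w) (hw : |w' - w| ≤ 1) : |w' - 2 * Real.pi * k| < Real.pi := by
  have hpi := Real.pi_gt_three
  have hle : |w - 2 * Real.pi * k| ≤ 2 * Real.pi / 3 := by
    by_contra! hlt
    have h1 := Real.cos_lt_cos_of_nonneg_of_le_pi (by positivity) hk hlt
    have h2 : Real.cos (2 * Real.pi / 3) = -(1 / 2) := by
      rw [show 2 * Real.pi / 3 = Real.pi - Real.pi / 3 by ring, Real.cos_pi_sub,
        Real.cos_pi_div_three]
    rw [Real.cos_abs, show w - 2 * Real.pi * k = w - k * (2 * Real.pi) by ring,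
      Real.cos_sub_int_mul_two_pi, h2] at h1
    linarith
  have htri := abs_add_le (w' - w) (w - 2 * Real.pi * k)
  rw [sub_add_sub_cancel] at htri
  linarith

lemma exists_int_abs_sub_le_pi (w : ℝ) : ∃ k : ℤ, |w - 2 * Real.pi * k| ≤ Real.pi := by
  refine ⟨round (w / (2 * Real.pi)), ?_⟩
  have h1 := abs_sub_round (w / (2 * Real.pi))
  have hpi := Real.pi_pos
  have h2 : w - 2 * Real.pi * round (w / (2 * Real.pi)) =
      2 * Real.pi * (w / (2 * Real.pi) - round (w / (2 * Real.pi))) := by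
    field_simp
  rw [h2, abs_mul, abs_of_pos (by positivity)]
  nlinarith

lemma int_eq_of_abs_sub_lt_pi {w : ℝ} {k k' : ℤ} (hk : |w - 2 * Real.pi * k| < Real.pi)
    (hk' : |w - 2 * Real.pi * k'| < Real.pi) : k = k' := by
  have hpi := Real.pi_pos
  rw [abs_lt] at hk hk'
  have key : ∀ a b : ℤ, 2 * Real.pi * a < 2 * Real.pi * b + 2 * Real.pi → a ≤ b := by
    intro a b hab
    have h1 : (a : ℝ) < b + 1 := by nlinarith
    exact Int.lt_add_one_iff.1 (by exact_mod_cast h1)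
  exact le_antisymm (key _ _ (by linarith)) (key _ _ (by linarith))

/-- Let `f : Y → X` be a Lipschitz map whose fibres over sets of diameter at most `D` are
controlled up to the ambiguity of angular coordinates `u i`, the map `f` itself seeing only
`cos (u i)`. Then preimages of the members of a colored covering of `X` split into small pieces
forming a colored covering of `Y`. -/
lemma exists_cover_of_folded_map {ι X Y : Type*} [Finite ι] [PseudoMetricSpace X]
    [PseudoMetricSpace Y] {k : ℕ} {F : Fin k → Set (Set X)} {D ε : ℝ}
    (hopen : ∀ i, ∀ W ∈ F i, IsOpen W) (hdisj : ∀ i, (F i).Pairwise Disjoint)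
    (hdiam : ∀ i, ∀ W ∈ F i, ∀ x ∈ W, ∀ y ∈ W, dist x y ≤ D)
    (hleb : ∀ x, ∃ i, ∃ W ∈ F i, ball x ε ⊆ W)
    (f : Y → X) (u : ι → Y → ℝ) (hf : Continuous f) (hu : ∀ i, Continuous (u i))
    {L τ : ℝ} (hL : 0 < L)
    (hfL : ∀ x y, dist x y < L → dist (f x) (f y) < ε)
    (huL : ∀ i x y, dist x y < L → |u i x - u i y| ≤ 1)
    (hcos : ∀ i x y, dist (f x) (f y) ≤ D → |Real.cos (u i x) - Real.cos (u i y)| ≤ 1)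
    (hτ : ∀ x y, dist (f x) (f y) ≤ D → (∀ i, |u i x - u i y| ≤ 2 * Real.pi) → dist x y ≤ τ) :
    ∃ U : Set (Set Y), IsLMNCover U Set.univ L τ k := by
  have hoff : ∀ W : Set X, ∀ i : ι, ∃ o : ℝ, (∀ x ∈ W, ∀ y ∈ W, dist x y ≤ D) →
      ∀ x, f x ∈ W → -(1 / 2) ≤ Real.cos (u i x - o) := by
    intro W i
    by_cases hall : ∀ x, f x ∈ W → -(1 / 2) ≤ Real.cos (u i x)
    · exact ⟨0, fun _ x hx => by simpa using hall x hx⟩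
    · push Not at hall
      obtain ⟨x₀, hx₀, hlt⟩ := hall
      refine ⟨Real.pi, fun hW x hx => ?_⟩
      rw [Real.cos_sub_pi]
      have h1 := (abs_le.1 (hcos i x x₀ (hW _ hx _ hx₀))).2
      linarith
  choose o ho using hoff
  let P : Set X → (ι → ℤ) → Set Y := fun W c =>
    {y | f y ∈ W ∧ ∀ i, |u i y - o W i - 2 * Real.pi * c i| < Real.pi}
  let G : Fin k → Set (Set Y) := fun j => {V | ∃ W ∈ F j, ∃ c, V = P W c}
  have hball : ∀ y, ∃ V ∈ ⋃ j, G j, ball y L ⊆ V := by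
    intro y
    obtain ⟨j, W, hW, hyW⟩ := hleb (f y)
    choose c hc using fun i => exists_int_abs_sub_le_pi (u i y - o W i)
    refine ⟨P W c, Set.mem_iUnion.2 ⟨j, W, hW, c, rfl⟩, fun x hx => ?_⟩
    rw [mem_ball] at hx
    have hy : f y ∈ W := by
      refine hyW (mem_ball_self ?_)
      exact dist_nonneg.trans_lt (hfL y y (by simpa using hL))
    refine ⟨hyW (mem_ball.2 (hfL x y hx)), fun i => ?_⟩
    refine abs_sub_lt_pi_of_cos (hc i) (ho W i (hdiam j W hW) y hy) ?_
    rw [sub_sub_sub_cancel_right]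
    exact huL i x y hx
  refine ⟨⋃ j, G j, ?_, ?_, ⟨G, rfl, ?_⟩, meshF_le_ofReal ?_, ofReal_le_lebesgueF hball⟩
  · intro V hV
    obtain ⟨j, W, hW, c, rfl⟩ := Set.mem_iUnion.1 hV
    refine (hf.isOpen_preimage W (hopen j W hW)).inter ?_
    change IsOpen {y | ∀ i, |u i y - o W i - 2 * Real.pi * c i| < Real.pi}
    rw [Set.ofPred_forall]
    refine isOpen_iInter_of_finite fun i => isOpen_lt ?_ continuous_const
    exact (((hu i).sub continuous_const).sub continuous_const).abs
  · intro y _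
    obtain ⟨V, hV, hyV⟩ := hball y
    exact ⟨V, hV, hyV (mem_ball_self hL)⟩
  · rintro j _ ⟨W, hW, c, rfl⟩ _ ⟨W', hW', c', rfl⟩ hne
    refine Set.disjoint_left.2 ?_
    rintro y ⟨hy, hyc⟩ ⟨hy', hyc'⟩
    by_cases hWW : W = W'
    · subst hWW
      exact hne (congrArg _ (funext fun i => int_eq_of_abs_sub_lt_pi (hyc i) (hyc' i)))
    · exact Set.disjoint_left.1 (hdisj j hW hW' hWW) hy hy'
  · intro V hV x hx y hy
    obtain ⟨j, W, hW, c, rfl⟩ := Set.mem_iUnion.1 hV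
    refine hτ x y (hdiam j W hW _ hx.1 _ hy.1) fun i => ?_
    have h1 := abs_lt.1 (hx.2 i)
    have h2 := abs_lt.1 (hy.2 i)
    rw [abs_le]
    constructor <;> linarith [h1.1, h1.2, h2.1, h2.2]

/-! ### Estimates in hyperbolic cones -/

lemma cosh_arcosh {x : ℝ} (hx : 1 ≤ x) : Real.cosh (arcosh x) = x := by
  have hsq : 0 ≤ x ^ 2 - 1 := by nlinarith
  have hs := Real.sq_sqrt hsq
  have hs0 := Real.sqrt_nonneg (x ^ 2 - 1)
  have hpos : 0 < x + Real.sqrt (x ^ 2 - 1) := by linarith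
  rw [arcosh, Real.cosh_log hpos]
  field_simp
  nlinarith

section HypCone

variable {Z C : Type*} [PseudoMetricSpace Z] [PseudoMetricSpace C] {h : Z × ℝ≥0 → C}

lemma IsHypCone.cosh_dist_s17 (hc : IsHypCone Z C h) (p q : Z × ℝ≥0) :
    Real.cosh (dist (h p) (h q)) = Real.cosh (p.2 - q.2 : ℝ) + Real.sinh p.2 * Real.sinh q.2 *
      (1 - Real.cos (Real.pi / Metric.diam (Set.univ : Set Z) * dist p.1 q.1)) := by
  have hp : 0 ≤ Real.sinh p.2 := Real.sinh_nonneg_iff.2 p.2.2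
  have hq : 0 ≤ Real.sinh q.2 := Real.sinh_nonneg_iff.2 q.2.2
  have hcos := Real.cos_le_one (Real.pi / Metric.diam (Set.univ : Set Z) * dist p.1 q.1)
  have hone := Real.one_le_cosh (p.2 - q.2 : ℝ)
  have hmul := mul_nonneg (mul_nonneg hp hq) (sub_nonneg.2 hcos)
  rw [hc.2, coneDist, cosh_arcosh] <;> rw [Real.cosh_sub] at *
  · ring
  · linarith

lemma IsHypCone.abs_sub_le_dist (hc : IsHypCone Z C h) (p q : Z × ℝ≥0) :
    |(p.2 - q.2 : ℝ)| ≤ dist (h p) (h q) := by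
  have hp : 0 ≤ Real.sinh p.2 := Real.sinh_nonneg_iff.2 p.2.2
  have hq : 0 ≤ Real.sinh q.2 := Real.sinh_nonneg_iff.2 q.2.2
  have hcos := Real.cos_le_one (Real.pi / Metric.diam (Set.univ : Set Z) * dist p.1 q.1)
  have hmul := mul_nonneg (mul_nonneg hp hq) (sub_nonneg.2 hcos)
  rw [← abs_of_nonneg (dist_nonneg (x := h p) (y := h q)), ← Real.cosh_le_cosh, hc.cosh_dist_s17]
  linarith

/-- Points of the cone at distance at most `D`, at heights at least `T`, have close
projections to the base. -/
lemma IsHypCone.dist_mul_sinh_le (hc : IsHypCone Z C h)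
    (hb : Bornology.IsBounded (Set.univ : Set Z)) (hd : 0 < Metric.diam (Set.univ : Set Z))
    {p q : Z × ℝ≥0} {T D : ℝ} (hT : 0 ≤ T) (hp : T ≤ p.2) (hq : T ≤ q.2)
    (hD : dist (h p) (h q) ≤ D) :
    dist p.1 q.1 * Real.sinh T ≤ Metric.diam (Set.univ : Set Z) * Real.cosh D := by
  have hr := Metric.dist_le_diam_of_mem hb (Set.mem_univ p.1) (Set.mem_univ q.1)
  have hcosh := hc.cosh_dist_s17 p q
  set Δ := Metric.diam (Set.univ : Set Z)
  set r := dist p.1 q.1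
  have hr0 : 0 ≤ r := dist_nonneg
  have hT0 : 0 ≤ Real.sinh T := Real.sinh_nonneg_iff.2 hT
  have hDD : Real.cosh (dist (h p) (h q)) ≤ Real.cosh D := by
    rw [Real.cosh_le_cosh, abs_of_nonneg dist_nonneg]
    exact hD.trans (le_abs_self D)
  have hsin : r / Δ ≤ Real.sin (Real.pi / Δ * r / 2) := by
    have h1 := Real.mul_le_sin (x := Real.pi / Δ * r / 2) (by positivity) (by
      rw [div_mul_eq_mul_div]
      have : Real.pi * r / Δ ≤ Real.pi := by
        rw [div_le_iff₀ hd]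
        exact mul_le_mul_of_nonneg_left hr Real.pi_pos.le
      linarith)
    refine le_trans (le_of_eq ?_) h1
    field_simp
  have hhalf : 1 - Real.cos (Real.pi / Δ * r) = 2 * Real.sin (Real.pi / Δ * r / 2) ^ 2 := by
    rw [Real.sin_sq_eq_half_sub, mul_div_cancel₀ _ (two_ne_zero)]
    ring
  have hss : Real.sinh T ^ 2 ≤ Real.sinh p.2 * Real.sinh q.2 := by
    rw [sq]
    exact mul_le_mul (Real.sinh_le_sinh.2 hp) (Real.sinh_le_sinh.2 hq) hT0
      (hT0.trans (Real.sinh_le_sinh.2 hp))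
  have hquot : 0 ≤ r / Δ := by positivity
  have hmain : (r / Δ * Real.sinh T) ^ 2 ≤ Real.cosh D ^ 2 := by
    have h1 : (r / Δ) ^ 2 ≤ Real.sin (Real.pi / Δ * r / 2) ^ 2 := pow_le_pow_left₀ hquot hsin 2
    have h2 : Real.sinh T ^ 2 * (r / Δ) ^ 2 ≤
        Real.sinh p.2 * Real.sinh q.2 * Real.sin (Real.pi / Δ * r / 2) ^ 2 :=
      mul_le_mul hss h1 (sq_nonneg _) ((sq_nonneg _).trans hss)
    rw [hhalf] at hcosh
    have h3 := Real.one_le_cosh (p.2 - q.2 : ℝ)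
    have h4 := Real.one_le_cosh D
    have h5 : 0 ≤ Real.sinh T ^ 2 * (r / Δ) ^ 2 := by positivity
    rw [mul_pow]
    nlinarith
  have hfin := (abs_le_of_sq_le_sq' hmain (Real.cosh_pos D).le).2
  rw [div_mul_eq_mul_div, div_le_iff₀ hd] at hfin
  linarith

lemma IsHypCone.dist_le (hc : IsHypCone Z C h) (hd : 0 < Metric.diam (Set.univ : Set Z))
    {p q : Z × ℝ≥0} {R : ℝ} (hq : q.2 ≤ R) :
    dist (h p) (h q) ≤ |(p.2 - q.2 : ℝ)| +
      Real.sinh R * (Real.pi / Metric.diam (Set.univ : Set Z) * dist p.1 q.1) := by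
  have hvert : dist (h p) (h (p.1, q.2)) ≤ |(p.2 - q.2 : ℝ)| := by
    rw [← abs_of_nonneg (dist_nonneg (x := h p)), ← Real.cosh_le_cosh, hc.cosh_dist_s17]
    simp
  have hhor : dist (h (p.1, q.2)) (h q) ≤
      Real.sinh q.2 * (Real.pi / Metric.diam (Set.univ : Set Z) * dist p.1 q.1) := by
    have hcosh := hc.cosh_dist_s17 (p.1, q.2) q
    simp only [sub_self, Real.cosh_zero] at hcosh
    set α := Real.pi / Metric.diam (Set.univ : Set Z) * dist p.1 q.1
    set ρ := dist (h (p.1, q.2)) (h q)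
    have hρ : 0 ≤ ρ := dist_nonneg
    have hα : 0 ≤ α := by positivity
    have hq0 : 0 ≤ Real.sinh q.2 := Real.sinh_nonneg_iff.2 q.2.2
    have h1 := Real.one_sub_sq_div_two_le_cos (x := α)
    have h2 : ρ / 2 ≤ Real.sinh (ρ / 2) := Real.self_le_sinh_iff.2 (by positivity)
    have h3 : Real.cosh ρ = 1 + 2 * Real.sinh (ρ / 2) ^ 2 := by
      have := Real.cosh_two_mul (ρ / 2)
      rw [mul_div_cancel₀ _ (two_ne_zero), Real.cosh_sq] at this
      linarith
    have h4 : (ρ / 2) ^ 2 ≤ Real.sinh (ρ / 2) ^ 2 := pow_le_pow_left₀ (by positivity) h2 2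
    have h5 := mul_le_mul_of_nonneg_left (show 1 - Real.cos α ≤ α ^ 2 / 2 by linarith)
      (mul_nonneg hq0 hq0)
    refine (abs_le_of_sq_le_sq' ?_ (by positivity)).2
    rw [mul_pow]
    nlinarith
  have hmono : Real.sinh q.2 * (Real.pi / Metric.diam (Set.univ : Set Z) * dist p.1 q.1) ≤
      Real.sinh R * (Real.pi / Metric.diam (Set.univ : Set Z) * dist p.1 q.1) :=
    mul_le_mul_of_nonneg_right (Real.sinh_le_sinh.2 hq) (by positivity)
  linarith [dist_triangle (h p) (h (p.1, q.2)) (h q)]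

end HypCone

lemma sinh_add_le {T K : ℝ} (hT : 1 ≤ Real.sinh T) (hK : 0 ≤ K) :
    Real.sinh (T + K) ≤ 3 * Real.exp K * Real.sinh T := by
  have h1 : Real.cosh T ≤ 2 * Real.sinh T := by
    refine (abs_le_of_sq_le_sq' ?_ (by linarith)).2
    rw [Real.cosh_sq]
    nlinarith
  have h2 : Real.sinh K ≤ Real.exp K := by
    rw [← Real.cosh_add_sinh]
    linarith [Real.cosh_pos K]
  have h3 : Real.cosh K ≤ Real.exp K := by
    rw [← Real.cosh_add_sinh]
    linarith [Real.sinh_nonneg_iff.2 hK]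
  have h4 := Real.sinh_nonneg_iff.2 hK
  rw [Real.sinh_add]
  nlinarith [Real.exp_pos K]

end PaperDefs

/-- **Proposition (asprod>).** For bounded metric spaces `Z₁, …, Zₙ` (of positive diameter),
`ℓ-dim (Z₁ × ⋯ × Zₙ × [0,1]ⁿ) ≤ asdim (Co Z₁ × ⋯ × Co Zₙ)`. -/
theorem elldim_le_asdim_cone_pi
    (n : ℕ) (Z : Fin n → Type*) [∀ i, MetricSpace (Z i)]
    (hb : ∀ i, Bornology.IsBounded (Set.univ : Set (Z i)))
    (hd : ∀ i, 0 < Metric.diam (Set.univ : Set (Z i)))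
    (C : Fin n → Type*) [∀ i, MetricSpace (C i)]
    (h : ∀ i, Z i × ℝ≥0 → C i) (hc : ∀ i, IsHypCone (Z i) (C i) (h i)) :
    elldim ((∀ i, Z i) × (Fin n → Set.Icc (0:ℝ) 1)) ≤ asdim (∀ i, C i) := by
  refine le_sInf ?_
  rintro _ ⟨m, rfl, hm⟩
  refine sInf_le ⟨m, rfl, ?_⟩
  obtain ⟨U, -, -, hmult, hmesh, hleb⟩ := hm 1 one_pos
  obtain ⟨D, hD0, hD⟩ := dist_le_of_meshF_lt_top hmesh
  have hhalf : ENNReal.ofReal (1 / 2) < lebesgueF U Set.univ :=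
    ((ENNReal.ofReal_lt_ofReal_iff one_pos).2 (by norm_num)).trans_le hleb
  obtain ⟨F, hFo, hFd, hFU, ε, hε, hFε⟩ := exists_colored_refinement hmult (by norm_num)
    (exists_ball_subset_of_lt_lebesgueF hhalf)
  have hFD : ∀ i, ∀ W ∈ F i, ∀ x ∈ W, ∀ y ∈ W, dist x y ≤ D := by
    intro i W hW x hx y hy
    obtain ⟨V, hV, hWV⟩ := hFU i W hW
    exact hD V hV x (hWV hx) y (hWV hy)
  obtain ⟨A₀, hA₀⟩ := Finite.bddAbove_range
    fun i => Metric.diam (Set.univ : Set (Z i)) * Real.cosh D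
  obtain ⟨B₀, hB₀⟩ := Finite.bddAbove_range
    fun i => Real.pi / Metric.diam (Set.univ : Set (Z i))
  obtain ⟨A, hA0, hA⟩ : ∃ A : ℝ, 0 < A ∧
      ∀ i, Metric.diam (Set.univ : Set (Z i)) * Real.cosh D ≤ A :=
    ⟨max A₀ 1, by positivity, fun i => (hA₀ ⟨i, rfl⟩).trans (le_max_left _ _)⟩
  obtain ⟨B, hB0, hB⟩ : ∃ B : ℝ, 0 < B ∧
      ∀ i, Real.pi / Metric.diam (Set.univ : Set (Z i)) ≤ B :=
    ⟨max B₀ 1, by positivity, fun i => (hB₀ ⟨i, rfl⟩).trans (le_max_left _ _)⟩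
  have hpi := Real.pi_pos
  set K : ℝ := 2 * (D + 1) with hK
  have hK0 : 0 < K := by positivity
  set Λ : ℝ := Real.pi * K + 3 * Real.exp K * A * B with hΛ
  have hΛ0 : 0 < Λ := by positivity
  set δ : ℝ := min (ε / Λ) (1 / (2 * Real.pi)) with hδ
  have hδ0 : 0 < δ := by positivity
  have hδε : Λ * δ ≤ ε := by
    rw [mul_comm, ← le_div_iff₀ hΛ0]
    exact min_le_left _ _
  have hδπ : 2 * Real.pi * δ ≤ 1 := by
    rw [mul_comm, ← le_div_iff₀ (by positivity)]
    exact min_le_right _ _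
  refine ⟨δ, ⟨hδ0, by nlinarith [Real.pi_gt_three]⟩, A, hA0, fun τ hτ0 hτA => ?_⟩
  set T : ℝ := Real.arsinh (A / τ) with hT
  have hsinhT : Real.sinh T = A / τ := Real.sinh_arsinh _
  have hT0 : 0 ≤ T := Real.arsinh_nonneg_iff.2 (by positivity)
  have hsinhTK : Real.sinh (T + K) ≤ 3 * Real.exp K * (A / τ) := by
    rw [← hsinhT]
    refine sinh_add_le ?_ hK0.le
    rw [hsinhT, le_div_iff₀ hτ0]
    linarith
  let u : Fin n → (∀ i, Z i) × (Fin n → Set.Icc (0:ℝ) 1) → ℝ :=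
    fun i y => 2 * Real.pi / τ * (y.2 i : ℝ)
  have hu : ∀ i x y, |u i x - u i y| = 2 * Real.pi / τ * dist (x.2 i) (y.2 i) := by
    intro i x y
    rw [← mul_sub, abs_mul, abs_of_pos (by positivity : 0 < 2 * Real.pi / τ), Subtype.dist_eq,
      Real.dist_eq]
  have hdist₁ : ∀ (x y : (∀ i, Z i) × (Fin n → Set.Icc (0:ℝ) 1)) i,
      dist (x.1 i) (y.1 i) ≤ dist x y :=
    fun x y i => (dist_le_pi_dist x.1 y.1 i).trans (le_max_left _ _)
  have hdist₂ : ∀ (x y : (∀ i, Z i) × (Fin n → Set.Icc (0:ℝ) 1)) i,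
      dist (x.2 i) (y.2 i) ≤ dist x y :=
    fun x y i => (dist_le_pi_dist x.2 y.2 i).trans (le_max_right _ _)
  have hu_le : ∀ i x y, |u i x - u i y| ≤ 2 * Real.pi / τ * dist x y := fun i x y => by
    rw [hu]
    exact mul_le_mul_of_nonneg_left (hdist₂ x y i) (by positivity)
  let t : Fin n → (∀ i, Z i) × (Fin n → Set.Icc (0:ℝ) 1) → ℝ :=
    fun i y => T + K / 2 * (1 - Real.cos (u i y))
  have htT : ∀ i y, T ≤ t i y := fun i y =>
    le_add_of_nonneg_right (mul_nonneg (by positivity) (sub_nonneg.2 (Real.cos_le_one _)))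
  have htK : ∀ i y, t i y ≤ T + K := fun i y => by
    have := Real.neg_one_le_cos (u i y)
    simp only [t]
    nlinarith
  have ht : ∀ i x y, |t i x - t i y| = K / 2 * |Real.cos (u i x) - Real.cos (u i y)| := by
    intro i x y
    rw [show t i x - t i y = K / 2 * (Real.cos (u i y) - Real.cos (u i x)) by simp only [t]; ring,
      abs_mul, abs_of_pos (by positivity : 0 < K / 2), abs_sub_comm]
  let f : (∀ i, Z i) × (Fin n → Set.Icc (0:ℝ) 1) → ∀ i, C i :=
    fun y i => h i (y.1 i, ⟨t i y, hT0.trans (htT i y)⟩)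
  have hf : ∀ x y, dist (f x) (f y) ≤ Λ / τ * dist x y := by
    intro x y
    refine (dist_pi_le_iff (by positivity)).2 fun i => ?_
    have h1 := (hc i).dist_le (hd i) (p := (x.1 i, ⟨t i x, hT0.trans (htT i x)⟩))
      (q := (y.1 i, ⟨t i y, hT0.trans (htT i y)⟩)) (htK i y)
    refine h1.trans ?_
    have h2 : |t i x - t i y| ≤ K / 2 * (2 * Real.pi / τ * dist x y) := by
      rw [ht]
      exact mul_le_mul_of_nonneg_left ((Real.abs_cos_sub_cos_le _ _).trans (hu_le i x y))
        (by positivity)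
    have h3 : Real.sinh (T + K) *
        (Real.pi / Metric.diam (Set.univ : Set (Z i)) * dist (x.1 i) (y.1 i)) ≤
        3 * Real.exp K * (A / τ) * (B * dist x y) :=
      mul_le_mul hsinhTK (mul_le_mul (hB i) (hdist₁ x y i) dist_nonneg hB0.le)
        (mul_nonneg (div_nonneg hpi.le (hd i).le) dist_nonneg) (by positivity)
    refine (add_le_add h2 h3).trans (le_of_eq ?_)
    rw [hΛ]
    field_simp
  refine exists_cover_of_folded_map hFo hFd hFD hFε f u ?_ ?_ (L := δ * τ) (by positivity)
    ?_ ?_ ?_ ?_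
  · exact (LipschitzWith.of_dist_le_mul (K := ⟨Λ / τ, by positivity⟩) hf).continuous
  · intro i
    fun_prop
  · intro x y hxy
    have h1 : Λ / τ * dist x y < Λ / τ * (δ * τ) := mul_lt_mul_of_pos_left hxy (by positivity)
    have h2 : Λ / τ * (δ * τ) = Λ * δ := by field_simp
    linarith [hf x y]
  · intro i x y hxy
    have h1 : 2 * Real.pi / τ * dist x y ≤ 2 * Real.pi / τ * (δ * τ) :=
      mul_le_mul_of_nonneg_left hxy.le (by positivity)
    have h2 : 2 * Real.pi / τ * (δ * τ) = 2 * Real.pi * δ := by field_simp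
    linarith [hu_le i x y]
  · intro i x y hxy
    have h1 : |t i x - t i y| ≤ dist (f x i) (f y i) :=
      (hc i).abs_sub_le_dist (x.1 i, ⟨t i x, hT0.trans (htT i x)⟩)
        (y.1 i, ⟨t i y, hT0.trans (htT i y)⟩)
    have h2 := (dist_le_pi_dist (f x) (f y) i).trans hxy
    rw [ht] at h1
    have h3 : K / 2 = D + 1 := by rw [hK]; ring
    rw [h3] at h1
    have h4 := abs_nonneg (Real.cos (u i x) - Real.cos (u i y))
    nlinarith
  · intro x y hxy hxyu
    refine max_le ((dist_pi_le_iff hτ0.le).2 fun i => ?_) ((dist_pi_le_iff hτ0.le).2 fun i => ?_)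
    · have h1 := (hc i).dist_mul_sinh_le (hb i) (hd i) hT0
        (p := (x.1 i, ⟨t i x, hT0.trans (htT i x)⟩))
        (q := (y.1 i, ⟨t i y, hT0.trans (htT i y)⟩)) (htT i x) (htT i y)
        ((dist_le_pi_dist (f x) (f y) i).trans hxy)
      have h2 := h1.trans (hA i)
      rw [hsinhT, ← mul_div_assoc, div_le_iff₀ hτ0, mul_comm] at h2
      exact le_of_mul_le_mul_left h2 hA0
    · have h1 := hxyu i
      rw [hu, div_mul_eq_mul_div, div_le_iff₀ hτ0] at h1
      exact le_of_mul_le_mul_left h1 (by positivity)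
end
end
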